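/- arXiv:2404.00460 — 3 statements merged into one kernel-verified Lean document; each statement's English description precedes it below -/
import Mathlib

section
/- There exists a constant C > 0 (depending on n, p and γ) such that for every continuously differentiable function u : ℝⁿ → ℝ one has ∫_{∂Ω_γ} |u|^p w dH^{n−1} ≤ C · ∫_{Ω_γ} (|∇u|^p + |u|^p) dx. -/
open MeasureTheory Metric Filter Set Topology
open scoped ENNReal NNReal

noncomputable section

open Classical in
/-- The outward cuspidal domain `Ω_γ ⊆ ℝ^{m+1}` (so `n = m + 1`): the cusp
`{(x', xₙ) : |x'| < γ(xₙ), 0 < xₙ ≤ 1}` together with the open ball of radius `√2`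
centred at `(0, 2) ∈ ℝ^m × ℝ`. -/
def cuspDomain (m : ℕ) (γ : ℝ → ℝ) : Set (EuclideanSpace ℝ (Fin (m + 1))) :=
  {x | Real.sqrt (∑ i : Fin m, x (Fin.castSucc i) ^ 2) < γ (x (Fin.last m)) ∧
      0 < x (Fin.last m) ∧ x (Fin.last m) ≤ 1} ∪
    Metric.ball (EuclideanSpace.single (Fin.last m) (2 : ℝ)) (Real.sqrt 2)

open Classical in
/-- The weight `w` on `∂Ω_γ`: `w = γ(xₙ)` at points of the lateral cusp surface
`|x'| = γ(xₙ) < 1` (these have `0 ≤ xₙ ≤ 1`), and `w = 1` at all other points. -/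
def cuspWeight (m : ℕ) (γ : ℝ → ℝ) (x : EuclideanSpace ℝ (Fin (m + 1))) : ℝ :=
  if Real.sqrt (∑ i : Fin m, x (Fin.castSucc i) ^ 2) = γ (x (Fin.last m)) ∧
      γ (x (Fin.last m)) < 1 ∧ 0 ≤ x (Fin.last m) ∧ x (Fin.last m) ≤ 1
  then γ (x (Fin.last m)) else 1

lemma abs_sub_le_of_sq_add_sum_sq {ι : Type*} (T : Finset ι) {v w : ι → ℝ} {a b r s κ : ℝ}
    (hr : 0 ≤ r) (hs : 0 ≤ s) (hκ : 0 < κ) (ha : r ≤ κ * a) (hb : s ≤ κ * b)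
    (hav : a ^ 2 + ∑ k ∈ T, v k ^ 2 = r ^ 2) (hbw : b ^ 2 + ∑ k ∈ T, w k ^ 2 = s ^ 2) :
    |a - b| ≤ κ * (|r - s| + ∑ k ∈ T, |v k - w k|) := by
  have ha0 : 0 ≤ a := nonneg_of_mul_nonneg_right (hr.trans ha) hκ
  have hb0 : 0 ≤ b := nonneg_of_mul_nonneg_right (hs.trans hb) hκ
  rcases (add_nonneg ha0 hb0).eq_or_lt with h0 | h0
  · obtain rfl : a = 0 := by linarith
    obtain rfl : b = 0 := by linarith
    simp only [sub_self, abs_zero]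
    positivity
  have hv : ∀ k ∈ T, |v k| ≤ r := fun k hk => abs_le_of_sq_le_sq (by
    have := Finset.single_le_sum (f := fun k => v k ^ 2) (fun i _ => sq_nonneg _) hk
    nlinarith [sq_nonneg a]) hr
  have hw : ∀ k ∈ T, |w k| ≤ s := fun k hk => abs_le_of_sq_le_sq (by
    have := Finset.single_le_sum (f := fun k => w k ^ 2) (fun i _ => sq_nonneg _) hk
    nlinarith [sq_nonneg b]) hs
  have hsum : |∑ k ∈ T, (v k ^ 2 - w k ^ 2)| ≤ (r + s) * ∑ k ∈ T, |v k - w k| := by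
    rw [Finset.mul_sum]
    refine (Finset.abs_sum_le_sum_abs _ _).trans (Finset.sum_le_sum fun k hk => ?_)
    rw [sq_sub_sq, abs_mul]
    gcongr
    exact (abs_add_le _ _).trans (add_le_add (hv k hk) (hw k hk))
  have hkey : |a - b| * (a + b) ≤ (r + s) * (|r - s| + ∑ k ∈ T, |v k - w k|) := by
    have h1 : |a - b| * (a + b) = |(r + s) * (r - s) - ∑ k ∈ T, (v k ^ 2 - w k ^ 2)| := by
      rw [← abs_of_pos h0, ← abs_mul, Finset.sum_sub_distrib]
      congr 1
      linear_combination hav - hbw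
    rw [h1, mul_add]
    refine (abs_sub _ _).trans (add_le_add ?_ hsum)
    rw [abs_mul, abs_of_nonneg (add_nonneg hr hs)]
  refine le_of_mul_le_mul_right (hkey.trans ?_) h0
  have : 0 ≤ |r - s| + ∑ k ∈ T, |v k - w k| := by positivity
  nlinarith

lemma Real.rpow_sub_one_mul_le_add {a b p : ℝ} (ha : 0 ≤ a) (hb : 0 ≤ b) (hp : 1 < p) :
    a ^ (p - 1) * b ≤ b ^ p + a ^ p := by
  have h : ∀ x : ℝ, 0 ≤ x → x ^ (p - 1) * x = x ^ p := fun x hx => by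
    rw [← Real.rpow_add_one' hx (by linarith), sub_add_cancel]
  have hap := Real.rpow_nonneg ha p
  have hbp := Real.rpow_nonneg hb p
  rcases le_total b a with hba | hab
  · calc a ^ (p - 1) * b ≤ a ^ (p - 1) * a := by gcongr
      _ ≤ _ := by rw [h a ha]; linarith
  · calc a ^ (p - 1) * b ≤ b ^ (p - 1) * b := by gcongr
      _ ≤ _ := by rw [h b hb]; linarith

lemma ofReal_abs_sub_mul_abs_rpow_le_lintegral {p : ℝ} (hp : 1 < p) {φ φ' d : ℝ → ℝ}
    (hφ : ∀ s, HasDerivAt φ (φ' s) s) (hφ' : Continuous φ') (hd : ∀ s, |φ' s| ≤ d s)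
    {a b c : ℝ} (hb : |a - c| ≤ b) :
    ENNReal.ofReal (|a - c| * |φ a| ^ p) ≤
      ∫⁻ s in uIoc c a, ENNReal.ofReal ((1 + b * p) * (d s ^ p + |φ s| ^ p)) := by
  have hφc : Continuous φ := continuous_iff_continuousAt.2 fun s => (hφ s).continuousAt
  set F : ℝ → ℝ := fun s => (s - c) * |φ s| ^ p
  set F' : ℝ → ℝ := fun s => 1 * |φ s| ^ p + (s - c) * (p * |φ s| ^ (p - 2) * φ s * φ' s)
  have hF : ∀ s, HasDerivAt F (F' s) s := fun s =>
    ((hasDerivAt_id s).sub_const c).mul ((hasDerivAt_abs_rpow (φ s) hp).comp s (hφ s))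
  have hcont : Continuous fun x : ℝ => p * |x| ^ (p - 2) * x := by
    have h1 : ContDiff ℝ 1 fun x : ℝ => |x| ^ p := by
      simpa only [Real.norm_eq_abs] using contDiff_norm_rpow (E := ℝ) hp
    have h2 := h1.continuous_deriv le_rfl
    have : deriv (fun x : ℝ => |x| ^ p) = fun x : ℝ => p * |x| ^ (p - 2) * x :=
      funext fun x => (hasDerivAt_abs_rpow x hp).deriv
    rwa [this] at h2
  have hF'c : Continuous F' := by
    have h1 : Continuous fun s => p * |φ s| ^ (p - 2) * φ s := hcont.comp hφc
    have h2 : Continuous fun s => |φ s| ^ p :=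
      hφc.abs.rpow_const fun s => Or.inr (by linarith)
    exact (continuous_const.mul h2).add
      ((continuous_id.sub continuous_const).mul (h1.mul hφ'))
  have hftc : ∫ s in c..a, F' s = (a - c) * |φ a| ^ p := by
    rw [intervalIntegral.integral_eq_sub_of_hasDerivAt (fun s _ => hF s)
      (hF'c.intervalIntegrable _ _)]
    simp [F]
  have hbound : ∀ s ∈ uIoc c a, |F' s| ≤ (1 + b * p) * (d s ^ p + |φ s| ^ p) := by
    intro s hs
    have hsc : |s - c| ≤ b := by
      refine le_trans ?_ hb
      rcases mem_uIoc.1 hs with h | h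
      · rw [abs_of_nonneg (by linarith), abs_of_nonneg (by linarith)]; linarith
      · rw [abs_of_nonpos (by linarith), abs_of_nonpos (by linarith)]; linarith
    have hd0 : 0 ≤ d s := (abs_nonneg _).trans (hd s)
    have hy := Real.rpow_sub_one_mul_le_add (abs_nonneg (φ s)) hd0 hp
    have hpw : |φ s| ^ (p - 2) * |φ s| = |φ s| ^ (p - 1) := by
      rw [← Real.rpow_add_one' (abs_nonneg _) (by linarith)]
      congr 1; ring
    have hdp := Real.rpow_nonneg hd0 p
    have hφp := Real.rpow_nonneg (abs_nonneg (φ s)) p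
    have h1 : |p * |φ s| ^ (p - 2) * φ s * φ' s| ≤ p * (d s ^ p + |φ s| ^ p) := by
      rw [abs_mul, abs_mul, abs_mul, abs_of_pos (by linarith : 0 < p),
        abs_of_nonneg (Real.rpow_nonneg (abs_nonneg (φ s)) _), mul_assoc p, hpw, mul_assoc]
      gcongr
      exact (mul_le_mul_of_nonneg_left (hd s) (Real.rpow_nonneg (abs_nonneg _) _)).trans hy
    calc |F' s| ≤ |φ s| ^ p + |s - c| * |p * |φ s| ^ (p - 2) * φ s * φ' s| := by
          refine (abs_add_le _ _).trans ?_
          rw [abs_mul (s - c), one_mul, abs_of_nonneg hφp]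
      _ ≤ (d s ^ p + |φ s| ^ p) + b * (p * (d s ^ p + |φ s| ^ p)) := by
          gcongr
          · linarith
          · exact (abs_nonneg _).trans hsc
      _ = _ := by ring
  calc ENNReal.ofReal (|a - c| * |φ a| ^ p) = ‖∫ s in c..a, F' s‖ₑ := by
        rw [hftc, ← ofReal_norm, Real.norm_eq_abs, abs_mul,
          abs_of_nonneg (Real.rpow_nonneg (abs_nonneg (φ a)) p)]
    _ = ‖∫ s in uIoc c a, F' s‖ₑ := by
        rw [← ofReal_norm, intervalIntegral.norm_intervalIntegral_eq, ofReal_norm]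
    _ ≤ ∫⁻ s in uIoc c a, ‖F' s‖ₑ := enorm_integral_le_lintegral_enorm _
    _ ≤ _ := by
        refine setLIntegral_mono' measurableSet_uIoc fun s hs => ?_
        rw [← ofReal_norm]
        exact ENNReal.ofReal_le_ofReal (hbound s hs)

lemma lipschitz_of_derivative_monotone {γ γ' : ℝ → ℝ}
    (hγmono : MonotoneOn γ (Icc 0 1))
    (hγderiv : ∀ t ∈ Icc (0 : ℝ) 1, HasDerivWithinAt γ (γ' t) (Icc 0 1) t)
    (hγ'mono : MonotoneOn γ' (Ioo 0 1)) :
    ∃ L : ℝ, 0 ≤ L ∧ ∀ s ∈ Icc (0 : ℝ) 1, ∀ t ∈ Icc (0 : ℝ) 1, |γ s - γ t| ≤ L * |s - t| := by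
  have hderiv : ∀ t ∈ Ioo (0 : ℝ) 1, HasDerivAt γ (γ' t) t := fun t ht =>
    (hγderiv t (Ioo_subset_Icc_self ht)).hasDerivAt (Icc_mem_nhds ht.1 ht.2)
  have hconv : ConvexOn ℝ (Icc 0 1) γ := by
    refine MonotoneOn.convexOn_of_deriv (convex_Icc 0 1)
      (fun t ht => (hγderiv t ht).continuousWithinAt) ?_ ?_
    · rw [interior_Icc]
      exact fun t ht => (hderiv t ht).differentiableAt.differentiableWithinAt
    · rw [interior_Icc]
      intro s hs t ht hst
      rw [(hderiv s hs).deriv, (hderiv t ht).deriv]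
      exact hγ'mono hs ht hst
  have hend : ∀ t ∈ Ico (0 : ℝ) 1, slope γ t 1 ≤ γ' 1 := fun t ht =>
    hconv.slope_le_of_hasDerivWithinAt ⟨ht.1, ht.2.le⟩ (by simp) ht.2 (hγderiv 1 (by simp))
  have hL : 0 ≤ γ' 1 := by
    refine le_trans ?_ (hend 0 (by simp))
    rw [slope_def_field]
    have := hγmono (by simp : (0 : ℝ) ∈ Icc (0 : ℝ) 1) (by simp : (1 : ℝ) ∈ Icc (0 : ℝ) 1) zero_le_one
    norm_num
    linarith
  have main : ∀ s ∈ Icc (0 : ℝ) 1, ∀ t ∈ Icc (0 : ℝ) 1, s < t → γ t - γ s ≤ γ' 1 * (t - s) := by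
    intro s hs t ht hst
    rw [← div_le_iff₀ (by linarith)]
    rcases ht.2.eq_or_lt with rfl | ht1
    · simpa [slope_def_field] using hend s ⟨hs.1, hst⟩
    · refine (hconv.slope_mono_adjacent hs (by simp) hst ht1).trans ?_
      simpa [slope_def_field] using hend t ⟨ht.1, ht1⟩
  refine ⟨γ' 1, hL, fun s hs t ht => ?_⟩
  rcases lt_trichotomy s t with h | rfl | h
  · rw [abs_of_nonpos (by linarith [hγmono hs ht h.le]), abs_of_neg (by linarith)]
    linarith [main s hs t ht h]
  · simp
  · rw [abs_of_nonneg (by linarith [hγmono ht hs h.le]), abs_of_pos (by linarith)]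
    exact main t ht s hs h

lemma setLIntegral_hausdorffMeasure_le_of_antilipschitz {E : Type*} [NormedAddCommGroup E]
    [NormedSpace ℝ E] [FiniteDimensional ℝ E] [MeasurableSpace E] [BorelSpace E] {m : ℕ}
    {π : E → Fin m → ℝ} {S : Set E} {K : ℝ≥0}
    (hπ : ∀ x ∈ S, ∀ y ∈ S, dist x y ≤ K * dist (π x) (π y)) {F : E → ℝ≥0∞}
    {g : (Fin m → ℝ) → ℝ≥0∞} (hg : Measurable g) (hFg : ∀ x ∈ S, F x ≤ g (π x)) :
    ∫⁻ x in S, F x ∂μH[(m : ℝ)] ≤ (K : ℝ≥0∞) ^ m * ∫⁻ y, g y := by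
  rcases S.eq_empty_or_nonempty with rfl | ⟨x₀, -⟩
  · simp
  have : Nonempty E := ⟨x₀⟩
  have hinj : InjOn π S := fun x hx y hy hxy => by
    have := hπ x hx y hy
    rw [hxy, dist_self, mul_zero] at this
    exact dist_le_zero.1 this
  have hlip : LipschitzOnWith K (Function.invFunOn π S) (π '' S) := by
    refine LipschitzOnWith.of_dist_le_mul ?_
    rintro _ ⟨x, hx, rfl⟩ _ ⟨y, hy, rfl⟩
    rw [hinj.leftInvOn_invFunOn hx, hinj.leftInvOn_invFunOn hy]
    exact hπ x hx y hy
  obtain ⟨ψ, hψ, hψeq⟩ := hlip.extend_finite_dimension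
  have hψm : Measurable ψ := hψ.continuous.measurable
  have hψπ : ∀ x ∈ S, ψ (π x) = x := fun x hx => by
    rw [← hψeq (mem_image_of_mem π hx), hinj.leftInvOn_invFunOn hx]
  have hle : (μH[(m : ℝ)] : Measure E).restrict S ≤
      ((K : ℝ≥0∞) ^ m) • (volume.restrict (π '' S)).map ψ := by
    refine Measure.le_iff.2 fun A hA => ?_
    rw [Measure.restrict_apply hA, Measure.smul_apply, Measure.map_apply hψm hA,
      Measure.restrict_apply (hψm hA), smul_eq_mul]
    have himg : A ∩ S = Function.invFunOn π S '' (π '' (A ∩ S)) := by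
      rw [image_image]
      conv_lhs => rw [← image_id (A ∩ S)]
      exact image_congr fun x hx => (hinj.leftInvOn_invFunOn hx.2).symm
    have hvol : (μH[(m : ℝ)] : Measure (Fin m → ℝ)) = volume := by
      simpa using hausdorffMeasure_pi_real (ι := Fin m)
    calc (μH[(m : ℝ)] : Measure E) (A ∩ S)
        ≤ (K : ℝ≥0∞) ^ (m : ℝ) * μH[(m : ℝ)] (π '' (A ∩ S)) := by
          conv_lhs => rw [himg]
          exact (hlip.mono (image_mono inter_subset_right)).hausdorffMeasure_image_le
            (Nat.cast_nonneg m)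
      _ ≤ _ := by
          rw [hvol, ENNReal.rpow_natCast]
          gcongr
          rintro _ ⟨x, hx, rfl⟩
          exact ⟨by rw [mem_preimage, hψπ x hx.2]; exact hx.1, mem_image_of_mem π hx.2⟩
  calc ∫⁻ x in S, F x ∂μH[(m : ℝ)]
      ≤ ∫⁻ x, F x ∂(((K : ℝ≥0∞) ^ m) • (volume.restrict (π '' S)).map ψ) :=
        lintegral_mono' hle le_rfl
    _ = (K : ℝ≥0∞) ^ m * ∫⁻ x, F x ∂((volume.restrict (π '' S)).map ψ) := by
        rw [lintegral_smul_measure, smul_eq_mul]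
    _ ≤ (K : ℝ≥0∞) ^ m * ∫⁻ y in π '' S, F (ψ y) := by
        gcongr
        exact lintegral_map_le _ _
    _ ≤ (K : ℝ≥0∞) ^ m * ∫⁻ y in π '' S, g y := by
        gcongr 1
        refine setLIntegral_mono hg ?_
        rintro _ ⟨x, hx, rfl⟩
        rw [hψπ x hx]
        exact hFg x hx
    _ ≤ _ := by
        gcongr
        exact Measure.restrict_le_self

lemma lintegral_euclideanSpace_insertNth {m : ℕ} (i : Fin (m + 1))
    {f : EuclideanSpace ℝ (Fin (m + 1)) → ℝ≥0∞} (hf : Measurable f) :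
    ∫⁻ y : Fin m → ℝ, ∫⁻ s : ℝ, f (WithLp.toLp 2 (i.insertNth s y)) = ∫⁻ x, f x := by
  have h1 := (PiLp.volume_preserving_toLp (Fin (m + 1))).lintegral_comp hf
  have hfm : Measurable fun x : Fin (m + 1) → ℝ => f (WithLp.toLp 2 x) :=
    hf.comp (PiLp.volume_preserving_toLp (Fin (m + 1))).measurable
  have h2 := (volume_preserving_piFinSuccAbove (fun _ : Fin (m + 1) => ℝ) i).symm.lintegral_comp hfm
  rw [← h1, ← h2, Measure.volume_eq_prod, lintegral_prod_symm']
  · rfl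
  · exact hfm.comp (MeasurableEquiv.measurable _)

lemma measurable_lintegral_insertNth {m : ℕ} (i : Fin (m + 1))
    {f : EuclideanSpace ℝ (Fin (m + 1)) → ℝ≥0∞} (hf : Measurable f) :
    Measurable fun y : Fin m → ℝ => ∫⁻ s : ℝ, f (WithLp.toLp 2 (i.insertNth s y)) := by
  have hfm : Measurable fun x : Fin (m + 1) → ℝ => f (WithLp.toLp 2 x) :=
    hf.comp (PiLp.volume_preserving_toLp (Fin (m + 1))).measurable
  exact Measurable.lintegral_prod_left'
    (hfm.comp (MeasurableEquiv.piFinSuccAbove (fun _ : Fin (m + 1) => ℝ) i).symm.measurable)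

lemma norm_gradient {E : Type*} [NormedAddCommGroup E] [InnerProductSpace ℝ E] [CompleteSpace E]
    (u : E → ℝ) (x : E) : ‖gradient u x‖ = ‖fderiv ℝ u x‖ := by
  rw [gradient, LinearIsometryEquiv.norm_map]

lemma ContDiff.continuous_gradient {E : Type*} [NormedAddCommGroup E] [InnerProductSpace ℝ E]
    [CompleteSpace E] {u : E → ℝ} (hu : ContDiff ℝ 1 u) : Continuous (gradient u) :=
  (LinearIsometryEquiv.continuous _).comp (hu.continuous_fderiv one_ne_zero)

lemma continuous_norm_gradient_rpow_add {E : Type*} [NormedAddCommGroup E] [InnerProductSpace ℝ E]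
    [CompleteSpace E] {u : E → ℝ} (hu : ContDiff ℝ 1 u) {p : ℝ} (hp : 0 ≤ p) :
    Continuous fun x => ‖gradient u x‖ ^ p + |u x| ^ p :=
  (hu.continuous_gradient.norm.rpow_const fun _ => Or.inr hp).add
    (hu.continuous.abs.rpow_const fun _ => Or.inr hp)

lemma hasDerivAt_toLp_update {ι : Type*} [Fintype ι] [DecidableEq ι] (x : ι → ℝ) (i : ι) (s : ℝ) :
    HasDerivAt (fun s => (WithLp.toLp 2 (Function.update x i s) : EuclideanSpace ℝ ι))
      (EuclideanSpace.single i 1) s :=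
  (PiLp.continuousLinearEquiv 2 ℝ (fun _ : ι => ℝ)).symm.hasFDerivAt.comp_hasDerivAt s
    (hasDerivAt_update x i s)

/-- The trace inequality on `S` with weight `w`, controlled by the Sobolev energy on `Ω`. -/
def TraceInequality {m : ℕ} (p : ℝ) (w : EuclideanSpace ℝ (Fin (m + 1)) → ℝ)
    (S Ω : Set (EuclideanSpace ℝ (Fin (m + 1)))) : Prop :=
  ∃ C : ℝ≥0, ∀ u : EuclideanSpace ℝ (Fin (m + 1)) → ℝ, ContDiff ℝ 1 u →
    ∫⁻ x in S, ENNReal.ofReal (|u x| ^ p * w x) ∂(μH[(m : ℝ)]) ≤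
      C * ∫⁻ x in Ω, ENNReal.ofReal (‖gradient u x‖ ^ p + |u x| ^ p)

namespace TraceInequality

variable {m : ℕ} {p : ℝ} {w : EuclideanSpace ℝ (Fin (m + 1)) → ℝ}
  {S T Ω Ω' : Set (EuclideanSpace ℝ (Fin (m + 1)))}

lemma mono (h : TraceInequality p w S Ω) (hT : T ⊆ S) (hΩ : Ω ⊆ Ω') :
    TraceInequality p w T Ω' := by
  obtain ⟨C, hC⟩ := h
  refine ⟨C, fun u hu => ?_⟩
  calc _ ≤ _ := lintegral_mono_set hT
    _ ≤ _ := hC u hu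
    _ ≤ _ := by
      gcongr

lemma iUnion {ι : Type*} [Fintype ι] {S : ι → Set (EuclideanSpace ℝ (Fin (m + 1)))}
    (h : ∀ k, TraceInequality p w (S k) Ω) : TraceInequality p w (⋃ k, S k) Ω := by
  choose C hC using h
  refine ⟨∑ k, C k, fun u hu => ?_⟩
  refine (lintegral_iUnion_le _ _).trans ?_
  rw [tsum_fintype, ENNReal.ofNNReal_finsetSum, Finset.sum_mul]
  exact Finset.sum_le_sum fun k _ => hC k u hu

lemma union (hS : TraceInequality p w S Ω) (hT : TraceInequality p w T Ω) :
    TraceInequality p w (S ∪ T) Ω := by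
  rw [union_eq_iUnion]
  exact iUnion (Bool.rec hT hS)

lemma of_graph (hp : 1 < p) (i : Fin (m + 1)) (hΩm : MeasurableSet Ω) {a b c K : ℝ} (ha : 0 ≤ a)
    (hK : ∀ x ∈ S, ∀ y ∈ S,
      |x i - y i| ≤ K * dist (i.removeNth x.ofLp) (i.removeNth y.ofLp))
    (hΩ : ∀ x ∈ S, ∀ s : ℝ, |s - c| < |x i - c| →
      WithLp.toLp 2 (Function.update x.ofLp i s) ∈ Ω)
    (hw : ∀ x ∈ S, w x ≤ a * |x i - c|) (hb : ∀ x ∈ S, |x i - c| ≤ b) :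
    TraceInequality p w S Ω := by
  obtain ⟨K₀, hK₀⟩ : ∃ K₀ : ℝ≥0, AntilipschitzWith K₀
      (WithLp.ofLp : EuclideanSpace ℝ (Fin (m + 1)) → Fin (m + 1) → ℝ) :=
    ⟨_, PiLp.antilipschitzWith_ofLp 2 (fun _ : Fin (m + 1) => ℝ)⟩
  set K₁ : ℝ≥0 := K₀ * (1 + K.toNNReal) with hK₁
  have hanti : ∀ x ∈ S, ∀ y ∈ S,
      dist x y ≤ K₁ * dist (i.removeNth x.ofLp) (i.removeNth y.ofLp) := by
    intro x hx y hy
    refine (hK₀.le_mul_dist x y).trans ?_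
    rw [hK₁, NNReal.coe_mul, mul_assoc]
    gcongr
    set D := dist (i.removeNth x.ofLp) (i.removeNth y.ofLp)
    have hD : 0 ≤ D := dist_nonneg
    rw [dist_pi_le_iff (by positivity)]
    have hKK : K ≤ K.toNNReal := Real.le_coe_toNNReal K
    have hK0 : (0 : ℝ) ≤ K.toNNReal := NNReal.coe_nonneg _
    push_cast at hKK hK0 ⊢
    intro k
    rcases eq_or_ne k i with rfl | hk
    · rw [Real.dist_eq]
      refine (hK x hx y hy).trans ?_
      nlinarith
    · obtain ⟨l, rfl⟩ := Fin.exists_succAbove_eq hk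
      have := dist_le_pi_dist (i.removeNth x.ofLp) (i.removeNth y.ofLp) l
      simp only [Fin.removeNth] at this
      refine this.trans ?_
      change D ≤ _
      nlinarith
  refine ⟨K₁ ^ m * (a.toNNReal * (1 + b * p).toNNReal), fun u hu => ?_⟩
  set G : EuclideanSpace ℝ (Fin (m + 1)) → ℝ := fun x => ‖gradient u x‖ ^ p + |u x| ^ p
  have hGc : Continuous G := continuous_norm_gradient_rpow_add hu (by linarith)
  set f : EuclideanSpace ℝ (Fin (m + 1)) → ℝ≥0∞ := Ω.indicator fun x => ENNReal.ofReal (G x)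
  have hfm : Measurable f := hGc.measurable.ennreal_ofReal.indicator hΩm
  set A : ℝ≥0∞ := a.toNNReal * (1 + b * p).toNNReal
  have hpt : ∀ x ∈ S, ENNReal.ofReal (|u x| ^ p * w x) ≤
      A * ∫⁻ s : ℝ, f (WithLp.toLp 2 (i.insertNth s (i.removeNth x.ofLp))) := by
    intro x hx
    have hb0 : 0 ≤ b := (abs_nonneg _).trans (hb x hx)
    set ℓ : ℝ → EuclideanSpace ℝ (Fin (m + 1)) :=
      fun s => WithLp.toLp 2 (Function.update x.ofLp i s)
    have hℓx : ℓ (x i) = x := by simp [ℓ]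
    have hℓ : ∀ s, HasDerivAt ℓ (EuclideanSpace.single i 1) s := hasDerivAt_toLp_update x.ofLp i
    have hℓc : Continuous ℓ := continuous_iff_continuousAt.2 fun s => (hℓ s).continuousAt
    have h1 := ofReal_abs_sub_mul_abs_rpow_le_lintegral hp (φ := u ∘ ℓ)
      (φ' := fun s => fderiv ℝ u (ℓ s) (EuclideanSpace.single i 1))
      (d := fun s => ‖gradient u (ℓ s)‖)
      (fun s => ((hu.differentiable one_ne_zero) (ℓ s)).hasFDerivAt.comp_hasDerivAt s (hℓ s))
      (((hu.continuous_fderiv one_ne_zero).comp hℓc).clm_apply continuous_const)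
      (fun s => by
        rw [norm_gradient, ← Real.norm_eq_abs]
        simpa using (fderiv ℝ u (ℓ s)).le_opNorm (EuclideanSpace.single i 1))
      (hb x hx)
    simp only [Function.comp_apply, hℓx] at h1
    calc ENNReal.ofReal (|u x| ^ p * w x)
        ≤ ENNReal.ofReal (a * (|x i - c| * |u x| ^ p)) := by
          refine ENNReal.ofReal_le_ofReal ?_
          have := mul_le_mul_of_nonneg_left (hw x hx) (Real.rpow_nonneg (abs_nonneg (u x)) p)
          linarith
      _ = ENNReal.ofReal a * ENNReal.ofReal (|x i - c| * |u x| ^ p) := ENNReal.ofReal_mul ha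
      _ ≤ ENNReal.ofReal a * ∫⁻ s in uIoc c (x i), ENNReal.ofReal ((1 + b * p) * G (ℓ s)) := by
          gcongr
      _ = A * ∫⁻ s in uIoc c (x i), ENNReal.ofReal (G (ℓ s)) := by
          have : ∀ s, ENNReal.ofReal ((1 + b * p) * G (ℓ s)) =
              ENNReal.ofReal (1 + b * p) * ENNReal.ofReal (G (ℓ s)) := fun s =>
            ENNReal.ofReal_mul (by nlinarith)
          simp_rw [this]
          rw [lintegral_const_mul' _ _ ENNReal.ofReal_ne_top, ← mul_assoc]
          rfl
      _ ≤ A * ∫⁻ s, f (ℓ s) := by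
          refine mul_le_mul' le_rfl ?_
          rw [← lintegral_indicator measurableSet_uIoc]
          refine lintegral_mono_ae ?_
          filter_upwards [compl_mem_ae_iff.2 (measure_singleton (μ := volume) (x i))] with s hs
          by_cases hsI : s ∈ uIoc c (x i)
          · have hmem : ℓ s ∈ Ω := by
              refine hΩ x hx s ?_
              have hne : s ≠ x i := hs
              rcases mem_uIoc.1 hsI with h | h
              · rw [abs_of_pos (by linarith), abs_of_pos (by linarith)]
                linarith [lt_of_le_of_ne h.2 hne]
              · rw [abs_of_nonpos (by linarith), abs_of_neg (by linarith)]
                linarith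
            rw [indicator_of_mem hsI]
            simp only [f]
            rw [indicator_of_mem hmem]
          · rw [indicator_of_notMem hsI]
            exact zero_le
      _ = _ := by simp only [Fin.insertNth_removeNth, ℓ]
  have hmain := setLIntegral_hausdorffMeasure_le_of_antilipschitz hanti
    ((measurable_lintegral_insertNth i hfm).const_mul A) hpt
  refine hmain.trans_eq ?_
  rw [lintegral_const_mul _ (measurable_lintegral_insertNth i hfm),
    lintegral_euclideanSpace_insertNth i hfm, lintegral_indicator hΩm, ← mul_assoc]
  push_cast
  rfl

lemma of_sphere_sections (hp : 1 < p) (hΩm : MeasurableSet Ω) (I : Finset (Fin (m + 1)))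
    (hI : I.Nonempty) (c : Fin (m + 1) → ℝ) {r : EuclideanSpace ℝ (Fin (m + 1)) → ℝ} {L R : ℝ}
    (hr : ∀ x ∈ S, 0 ≤ r x) (hrR : ∀ x ∈ S, r x ≤ R)
    (hsum : ∀ x ∈ S, ∑ k ∈ I, (x k - c k) ^ 2 = r x ^ 2)
    (hL : ∀ i ∈ I, ∀ x ∈ S, ∀ y ∈ S,
      |r x - r y| ≤ L * dist (i.removeNth x.ofLp) (i.removeNth y.ofLp))
    (hΩ : ∀ i ∈ I, ∀ x ∈ S, ∀ s : ℝ, |s - c i| < |x i - c i| →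
      WithLp.toLp 2 (Function.update x.ofLp i s) ∈ Ω)
    (hw : ∀ x ∈ S, w x ≤ r x) : TraceInequality p w S Ω := by
  set κ : ℝ := m + 1
  have hκ : 0 < κ := by positivity
  have hκ1 : 1 ≤ κ := by simp [κ]
  let σ : Bool → ℝ := fun ε => if ε then 1 else -1
  have hσ : ∀ ε, |σ ε| = 1 := by simp [σ]
  have hσ2 : ∀ ε, σ ε ^ 2 = 1 := by simp [σ]
  have hpiece : ∀ q : I × Bool,
      TraceInequality p w {x ∈ S | r x ≤ κ * (σ q.2 * (x q.1 - c q.1))} Ω := by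
    rintro ⟨⟨i, hi⟩, ε⟩
    refine of_graph hp i hΩm (a := κ) (b := R) (c := c i) (K := κ * (L + (I.erase i).card)) hκ.le
      ?_ (fun x hx => hΩ i hi x hx.1) ?_ ?_
    · rintro x ⟨hx, hx'⟩ y ⟨hy, hy'⟩
      set D := dist (i.removeNth x.ofLp) (i.removeNth y.ofLp)
      have hsplit : ∀ z ∈ S,
          (σ ε * (z i - c i)) ^ 2 + ∑ k ∈ I.erase i, (z k - c k) ^ 2 = r z ^ 2 := fun z hz => by
        rw [mul_pow, hσ2, one_mul, Finset.add_sum_erase I (fun k => (z k - c k) ^ 2) hi, hsum z hz]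
      have h1 := abs_sub_le_of_sq_add_sum_sq (I.erase i) (hr x hx) (hr y hy) hκ hx' hy'
        (hsplit x hx) (hsplit y hy)
      rw [← mul_sub, abs_mul, hσ, one_mul, sub_sub_sub_cancel_right] at h1
      refine h1.trans ?_
      rw [mul_assoc]
      gcongr
      rw [add_mul, ← nsmul_eq_mul]
      refine add_le_add (hL i hi x hx y hy) (Finset.sum_le_card_nsmul _ _ _ fun k hk => ?_)
      obtain ⟨l, rfl⟩ := Fin.exists_succAbove_eq (Finset.ne_of_mem_erase hk)
      rw [sub_sub_sub_cancel_right]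
      exact dist_le_pi_dist (i.removeNth x.ofLp) (i.removeNth y.ofLp) l
    · rintro x ⟨hx, hx'⟩
      refine (hw x hx).trans (hx'.trans ?_)
      gcongr
      refine (le_abs_self _).trans ?_
      rw [abs_mul, hσ, one_mul]
    · rintro x ⟨hx, -⟩
      refine (abs_le_of_sq_le_sq ?_ (hr x hx)).trans (hrR x hx)
      rw [← hsum x hx]
      exact Finset.single_le_sum (f := fun k => (x k - c k) ^ 2) (fun _ _ => sq_nonneg _) hi
  refine (iUnion hpiece).mono (fun x hx => ?_) le_rfl
  obtain ⟨i, hi, hle⟩ : ∃ i ∈ I, r x ≤ κ * |x i - c i| := by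
    by_contra! hcon
    have hr0 := hr x hx
    have hlt : ∑ k ∈ I, κ ^ 2 * (x k - c k) ^ 2 < ∑ k ∈ I, r x ^ 2 := by
      refine Finset.sum_lt_sum_of_nonempty hI fun k hk => ?_
      rw [← sq_abs (x k - c k), ← mul_pow]
      exact pow_lt_pow_left₀ (hcon k hk) (by positivity) two_ne_zero
    rw [← Finset.mul_sum, hsum x hx, Finset.sum_const, nsmul_eq_mul] at hlt
    have hcard : (I.card : ℝ) ≤ κ := by
      have := Finset.card_le_univ I
      rw [Fintype.card_fin] at this
      change (I.card : ℝ) ≤ m + 1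
      exact_mod_cast this
    nlinarith [sq_nonneg (r x), mul_nonneg (sub_nonneg.2 hcard) (sq_nonneg (r x)),
      mul_nonneg (mul_nonneg hκ.le (sub_nonneg.2 hκ1)) (sq_nonneg (r x))]
  refine mem_iUnion.2 ⟨(⟨i, hi⟩, decide (0 ≤ x i - c i)), hx, ?_⟩
  refine hle.trans_eq ?_
  by_cases h : 0 ≤ x i - c i
  · simp [σ, h, abs_of_nonneg]
  · have h' := h
    push Not at h'
    simp only [σ, h, abs_of_neg h', decide_false, Bool.false_eq_true, if_false, neg_one_mul]

end TraceInequality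

lemma sum_update_sub_sq_lt {ι : Type*} [DecidableEq ι] {I : Finset ι} {i : ι} (hi : i ∈ I)
    {x c : ι → ℝ} {s : ℝ} (hs : |s - c i| < |x i - c i|) :
    ∑ k ∈ I, (Function.update x i s k - c k) ^ 2 < ∑ k ∈ I, (x k - c k) ^ 2 := by
  refine Finset.sum_lt_sum (fun k _ => ?_) ⟨i, hi, ?_⟩
  · rcases eq_or_ne k i with rfl | hk
    · simpa using (sq_lt_sq.2 hs).le
    · rw [Function.update_of_ne hk]
  · simpa using sq_lt_sq.2 hs

section Cusp

variable {m : ℕ} {γ : ℝ → ℝ} {p : ℝ}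

lemma continuous_cross_radius :
    Continuous fun x : EuclideanSpace ℝ (Fin (m + 1)) =>
      Real.sqrt (∑ i : Fin m, x (Fin.castSucc i) ^ 2) := by
  fun_prop

lemma continuousOn_gap (hγ : ContinuousOn γ (Icc 0 1)) :
    ContinuousOn (fun x : EuclideanSpace ℝ (Fin (m + 1)) =>
      γ (x (Fin.last m)) - Real.sqrt (∑ i : Fin m, x (Fin.castSucc i) ^ 2))
      {x | x (Fin.last m) ∈ Icc (0 : ℝ) 1} := by
  refine ContinuousOn.sub (hγ.comp (by fun_prop) fun x hx => hx)
    continuous_cross_radius.continuousOn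

lemma isOpen_cusp (hγ : ContinuousOn γ (Icc 0 1)) :
    IsOpen {x : EuclideanSpace ℝ (Fin (m + 1)) | x (Fin.last m) ∈ Ioo (0 : ℝ) 1 ∧
      Real.sqrt (∑ i : Fin m, x (Fin.castSucc i) ^ 2) < γ (x (Fin.last m))} := by
  have hopen : IsOpen {x : EuclideanSpace ℝ (Fin (m + 1)) | x (Fin.last m) ∈ Ioo (0 : ℝ) 1} :=
    isOpen_Ioo.preimage (by fun_prop)
  convert ((continuousOn_gap (m := m) hγ).mono fun x hx =>
    Ioo_subset_Icc_self hx).isOpen_inter_preimage hopen (isOpen_Ioi (a := 0)) using 1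
  ext x
  exact and_congr_right fun _ => sub_pos.symm

lemma isClosed_cusp (hγ : ContinuousOn γ (Icc 0 1)) :
    IsClosed {x : EuclideanSpace ℝ (Fin (m + 1)) | x (Fin.last m) ∈ Icc (0 : ℝ) 1 ∧
      Real.sqrt (∑ i : Fin m, x (Fin.castSucc i) ^ 2) ≤ γ (x (Fin.last m))} := by
  have hclosed : IsClosed {x : EuclideanSpace ℝ (Fin (m + 1)) | x (Fin.last m) ∈ Icc (0 : ℝ) 1} :=
    isClosed_Icc.preimage (by fun_prop)
  convert (continuousOn_gap (m := m) hγ).preimage_isClosed_of_isClosed hclosed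
    (isClosed_Ici (a := 0)) using 1
  ext x
  exact and_congr_right fun _ => sub_nonneg.symm

lemma dist_single_last_sq (x : EuclideanSpace ℝ (Fin (m + 1))) (a : ℝ) :
    dist x (EuclideanSpace.single (Fin.last m) a) ^ 2 =
      ∑ i : Fin m, x (Fin.castSucc i) ^ 2 + (x (Fin.last m) - a) ^ 2 := by
  rw [EuclideanSpace.dist_eq, Real.sq_sqrt (by positivity), Fin.sum_univ_castSucc]
  simp [Real.dist_eq, sq_abs]

lemma frontier_cuspDomain_subset (hγ0 : γ 0 = 0) (hγ1 : γ 1 = 1)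
    (hγ : ContinuousOn γ (Icc 0 1)) :
    frontier (cuspDomain m γ) ⊆
      {x | x (Fin.last m) ∈ Ico (0 : ℝ) 1 ∧
        Real.sqrt (∑ i : Fin m, x (Fin.castSucc i) ^ 2) = γ (x (Fin.last m))} ∪
      sphere (EuclideanSpace.single (Fin.last m) 2) (Real.sqrt 2) := by
  intro x hx
  have hball : x ∉ ball (EuclideanSpace.single (Fin.last m) (2 : ℝ)) (Real.sqrt 2) := fun h =>
    hx.2 (interior_maximal (fun y hy => Or.inr hy) isOpen_ball h)
  have hcusp : x (Fin.last m) ∈ Ioo (0 : ℝ) 1 →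
      ¬ Real.sqrt (∑ i : Fin m, x (Fin.castSucc i) ^ 2) < γ (x (Fin.last m)) := fun h1 h2 =>
    hx.2 (interior_maximal (fun y hy => Or.inl ⟨hy.2, hy.1.1, hy.1.2.le⟩) (isOpen_cusp hγ) ⟨h1, h2⟩)
  have hcl : x ∈ closure (cuspDomain m γ) := hx.1
  rw [cuspDomain, closure_union] at hcl
  rcases hcl with hA | hB
  · obtain ⟨ht, hle⟩ := (isClosed_cusp hγ).closure_subset_iff.2
      (fun y hy => ⟨⟨hy.2.1.le, hy.2.2⟩, hy.1.le⟩) hA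
    rcases ht.2.eq_or_lt with h1 | h1
    · right
      refine le_antisymm ?_ (not_lt.1 hball)
      rw [h1, hγ1, Real.sqrt_le_iff] at hle
      refine Real.le_sqrt_of_sq_le ?_
      rw [dist_single_last_sq, h1]
      linarith
    · refine Or.inl ⟨⟨ht.1, h1⟩, hle.antisymm ?_⟩
      rcases ht.1.eq_or_lt with h0 | h0
      · rw [← h0, hγ0]
        exact Real.sqrt_nonneg _
      · exact not_lt.1 (hcusp ⟨h0, h1⟩)
  · exact Or.inr (le_antisymm (closure_ball_subset_closedBall hB) (not_lt.1 hball))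

lemma cuspWeight_le_one (x : EuclideanSpace ℝ (Fin (m + 1))) : cuspWeight m γ x ≤ 1 := by
  unfold cuspWeight
  split_ifs with h
  · exact h.2.1.le
  · exact le_rfl

lemma traceInequality_sphere (hp : 1 < p) :
    TraceInequality p (cuspWeight m γ) (sphere (EuclideanSpace.single (Fin.last m) 2) (Real.sqrt 2))
      (cuspDomain m γ) := by
  set z : EuclideanSpace ℝ (Fin (m + 1)) := EuclideanSpace.single (Fin.last m) 2
  have hdist : ∀ x : EuclideanSpace ℝ (Fin (m + 1)), ∑ k, (x k - z k) ^ 2 = dist x z ^ 2 := by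
    intro x
    rw [EuclideanSpace.dist_eq, Real.sq_sqrt (by positivity)]
    simp [Real.dist_eq, sq_abs]
  refine (TraceInequality.of_sphere_sections (Ω := ball z (Real.sqrt 2)) hp measurableSet_ball
    Finset.univ Finset.univ_nonempty z.ofLp (r := fun _ => Real.sqrt 2) (L := 0) (R := Real.sqrt 2)
    (fun _ _ => Real.sqrt_nonneg _) (fun _ _ => le_rfl) (fun x hx => ?_) (by simp)
    (fun i hi x hx s hs => ?_) (fun x _ => ?_)).mono le_rfl subset_union_right
  · rw [hdist, mem_sphere.1 hx]
  · rw [mem_ball]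
    have h := sum_update_sub_sq_lt hi hs
    have h' := hdist (WithLp.toLp 2 (Function.update x.ofLp i s))
    simp only at h'
    rw [hdist, h', mem_sphere.1 hx] at h
    exact lt_of_pow_lt_pow_left₀ 2 (Real.sqrt_nonneg _) h
  · exact (cuspWeight_le_one x).trans (Real.one_le_sqrt.2 one_le_two)

lemma traceInequality_cusp (hm : 1 ≤ m) (hp : 1 < p) (hγ0 : γ 0 = 0) (hγ1 : γ 1 = 1)
    (hγ : ContinuousOn γ (Icc 0 1)) (hγmono : StrictMonoOn γ (Icc 0 1))
    (hγnonneg : ∀ t ∈ Icc (0 : ℝ) 1, 0 ≤ γ t) {L : ℝ} (hL0 : 0 ≤ L)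
    (hL : ∀ s ∈ Icc (0 : ℝ) 1, ∀ t ∈ Icc (0 : ℝ) 1, |γ s - γ t| ≤ L * |s - t|) :
    TraceInequality p (cuspWeight m γ) {x | x (Fin.last m) ∈ Ico (0 : ℝ) 1 ∧
        Real.sqrt (∑ i : Fin m, x (Fin.castSucc i) ^ 2) = γ (x (Fin.last m))}
      (cuspDomain m γ) := by
  set I : Finset (Fin (m + 1)) := Finset.univ.map Fin.castSuccEmb
  have hsumI : ∀ x : Fin (m + 1) → ℝ,
      ∑ k ∈ I, (x k - (0 : Fin (m + 1) → ℝ) k) ^ 2 = ∑ i : Fin m, x (Fin.castSucc i) ^ 2 := by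
    simp [I]
  have hI : ∀ i ∈ I, Fin.last m ≠ i := by
    simp only [I, Finset.mem_map, Finset.mem_univ, true_and, Fin.castSuccEmb_apply]
    rintro _ ⟨k, rfl⟩
    exact (Fin.castSucc_ne_last k).symm
  have hlt : ∀ t ∈ Ico (0 : ℝ) 1, γ t < 1 := fun t ht => by
    rw [← hγ1]
    exact hγmono (Ico_subset_Icc_self ht) (by simp) ht.2
  refine (TraceInequality.of_sphere_sections hp (isOpen_cusp hγ).measurableSet I
    (Finset.map_nonempty.2 ⟨⟨0, hm⟩, Finset.mem_univ _⟩) 0 (r := fun x => γ (x (Fin.last m)))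
    (L := L) (R := 1) (fun x hx => hγnonneg _ (Ico_subset_Icc_self hx.1))
    (fun x hx => (hlt _ hx.1).le) (fun x hx => ?_) (fun i hi x hx y hy => ?_)
    (fun i hi x hx s hs => ?_) (fun x hx => ?_)).mono le_rfl
    fun x hx => Or.inl ⟨hx.2, hx.1.1, hx.1.2.le⟩
  · rw [hsumI, ← hx.2, Real.sq_sqrt (by positivity)]
  · refine (hL _ (Ico_subset_Icc_self hx.1) _ (Ico_subset_Icc_self hy.1)).trans ?_
    gcongr
    obtain ⟨l, hl⟩ := Fin.exists_succAbove_eq (hI i hi)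
    rw [← hl]
    exact dist_le_pi_dist (i.removeNth x.ofLp) (i.removeNth y.ofLp) l
  · have h := sum_update_sub_sq_lt hi hs
    rw [hsumI, hsumI] at h
    have h2 := Real.sqrt_lt_sqrt (by positivity) h
    rw [hx.2] at h2
    have ht : x (Fin.last m) ≠ 0 := fun h0 => by
      rw [h0, hγ0] at h2
      exact (Real.sqrt_nonneg _).not_gt h2
    refine ⟨?_, ?_⟩
    · simp only [Function.update_of_ne (hI i hi)]
      exact ⟨lt_of_le_of_ne hx.1.1 ht.symm, hx.1.2⟩
    · simp only [Function.update_of_ne (hI i hi)]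
      exact h2
  · unfold cuspWeight
    rw [if_pos ⟨hx.2, hlt _ hx.1, hx.1.1, hx.1.2.le⟩]

lemma isBounded_cuspDomain (hγ1 : γ 1 = 1) (hγmono : MonotoneOn γ (Icc 0 1)) :
    Bornology.IsBounded (cuspDomain m γ) := by
  refine Bornology.IsBounded.union ?_ isBounded_ball
  refine (isBounded_closedBall (x := EuclideanSpace.single (Fin.last m) (0 : ℝ))
    (r := Real.sqrt 2)).subset fun x hx => ?_
  have h1 : γ (x (Fin.last m)) ≤ 1 := by
    rw [← hγ1]
    exact hγmono ⟨hx.2.1.le, hx.2.2⟩ (by simp) hx.2.2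
  have h2 := (Real.sqrt_le_iff.1 (hx.1.le.trans h1)).2
  refine Real.le_sqrt_of_sq_le ?_
  rw [dist_single_last_sq]
  nlinarith [hx.2.1, hx.2.2]

end Cusp

theorem weighted_trace_inequality (m : ℕ) (hm : 1 ≤ m) (p : ℝ) (hp : 1 < p)
    (γ γ' : ℝ → ℝ) (hγ0 : γ 0 = 0) (hγ1 : γ 1 = 1)
    (hγcont : ContinuousOn γ (Set.Icc 0 1))
    (hγmono : StrictMonoOn γ (Set.Icc 0 1))
    (hγnonneg : ∀ t ∈ Set.Icc (0 : ℝ) 1, 0 ≤ γ t)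
    (hγderiv : ∀ t ∈ Set.Icc (0 : ℝ) 1, HasDerivWithinAt γ (γ' t) (Set.Icc 0 1) t)
    (hγ'mono : StrictMonoOn γ' (Set.Ioo 0 1))
    (hγ'lim : Filter.Tendsto γ' (nhdsWithin 0 (Set.Ioi 0)) (nhds 0))
    :
    ∃ C : ℝ, 0 < C ∧ ∀ u : EuclideanSpace ℝ (Fin (m + 1)) → ℝ, ContDiff ℝ 1 u →
      (∫⁻ x in frontier (cuspDomain m γ),
          ENNReal.ofReal (|u x| ^ p * cuspWeight m γ x) ∂(μH[(m : ℝ)]))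
        ≤ ENNReal.ofReal
            (C * ∫ x in cuspDomain m γ, (‖gradient u x‖ ^ p + |u x| ^ p)) := by
  obtain ⟨L, hL0, hL⟩ := lipschitz_of_derivative_monotone hγmono.monotoneOn hγderiv
    hγ'mono.monotoneOn
  obtain ⟨C, hC⟩ : TraceInequality p (cuspWeight m γ) (frontier (cuspDomain m γ))
      (cuspDomain m γ) :=
    ((traceInequality_cusp hm hp hγ0 hγ1 hγcont hγmono hγnonneg hL0 hL).union
      (traceInequality_sphere hp)).mono (frontier_cuspDomain_subset hγ0 hγ1 hγcont) le_rfl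
  refine ⟨C + 1, by positivity, fun u hu => (hC u hu).trans ?_⟩
  have hcont := continuous_norm_gradient_rpow_add hu (by linarith : 0 ≤ p)
  have hint : IntegrableOn (fun x => ‖gradient u x‖ ^ p + |u x| ^ p) (cuspDomain m γ) :=
    (hcont.continuousOn.integrableOn_compact
      (isBounded_cuspDomain hγ1 hγmono.monotoneOn).isCompact_closure).mono_set subset_closure
  rw [ENNReal.ofReal_mul (by positivity), ofReal_integral_eq_lintegral_ofReal hint
    (Eventually.of_forall fun x => by positivity)]
  gcongr
  rw [← ENNReal.ofReal_coe_nnreal]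
  exact ENNReal.ofReal_le_ofReal (by linarith)
end
end

section
/- For every sequence (u_k)_{k∈ℕ} of continuously differentiable functions u_k : ℝⁿ → ℝ satisfying ∫_{Ω_γ} (|∇u_k|^p + |u_k|^p) dx ≤ 1 for all k, there exist a subsequence (u_{k_j}) and a Borel measurable function g : ℝⁿ → ℝ with ∫_{∂Ω_γ} |g|^p w dH^{n−1} < ∞ such that ∫_{∂Ω_γ} |u_{k_j} − g|^p w dH^{n−1} → 0 as j → ∞. (This expresses the compactness of the trace embedding W^{1,p}(Ω_γ) ↪ L^p_w(∂Ω_γ) on the dense subclass of C¹ functions.) -/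
open MeasureTheory Metric Filter Set Topology
open scoped ENNReal NNReal

noncomputable section

section Control

lemma lintegral_rpow_le_measure_univ_mul {α : Type*} [MeasurableSpace α] (μ : Measure α)
    {p : ℝ} (hp : 1 < p) {f : α → ℝ≥0∞} (hf : AEMeasurable f μ) :
    (∫⁻ x, f x ∂μ) ^ p ≤ μ univ ^ (p - 1) * ∫⁻ x, f x ^ p ∂μ := by
  have hp0 : 0 < p := by linarith
  have h := ENNReal.lintegral_mul_le_Lp_mul_Lq μ (Real.HolderConjugate.conjExponent hp) hf
    (aemeasurable_const (b := (1 : ℝ≥0∞)))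
  simp only [Pi.mul_apply, mul_one, ENNReal.one_rpow, lintegral_const, one_mul] at h
  calc (∫⁻ x, f x ∂μ) ^ p
      ≤ ((∫⁻ x, f x ^ p ∂μ) ^ (1 / p) * μ univ ^ (1 / p.conjExponent)) ^ p := by gcongr
    _ = μ univ ^ (p - 1) * ∫⁻ x, f x ^ p ∂μ := by
      rw [ENNReal.mul_rpow_of_nonneg _ _ hp0.le, ← ENNReal.rpow_mul, ← ENNReal.rpow_mul, mul_comm]
      congr 1
      · congr 1
        rw [Real.conjExponent]
        field_simp
      · rw [one_div_mul_cancel hp0.ne', ENNReal.rpow_one]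

lemma exists_pos_mul_ofReal_rpow_le {A η : ℝ≥0∞} (hA : A ≠ ∞) (hη : η ≠ 0) {q : ℝ} (hq : 0 < q) :
    ∃ r₀ : ℝ, 0 < r₀ ∧ ∀ r : ℝ, 0 < r → r ≤ r₀ → A * ENNReal.ofReal r ^ q ≤ η := by
  have h : Tendsto (fun r : ℝ => A * ENNReal.ofReal r ^ q) (𝓝 0) (𝓝 0) := by
    have h1 : Tendsto (fun r : ℝ => ENNReal.ofReal r ^ q) (𝓝 0) (𝓝 0) := by
      have : Continuous fun r : ℝ => ENNReal.ofReal r ^ q :=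
        ENNReal.continuous_rpow_const.comp ENNReal.continuous_ofReal
      simpa [ENNReal.zero_rpow_of_pos hq] using this.tendsto 0
    simpa using ENNReal.Tendsto.const_mul h1 (Or.inr hA)
  have h2 := h.eventually (gt_mem_nhds (pos_iff_ne_zero.mpr hη))
  obtain ⟨ε, hε, hb⟩ := Metric.eventually_nhds_iff.mp h2
  refine ⟨ε / 2, by positivity, fun r hr hr' => (hb ?_).le⟩
  rw [Real.dist_eq, sub_zero, abs_of_pos hr]
  linarith

lemma enorm_rpow_le_average {E : Type*} [NormedAddCommGroup E] [MeasurableSpace E]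
    [BorelSpace E] [ProperSpace E] (μ : Measure E) [IsFiniteMeasureOnCompacts μ]
    [μ.IsOpenPosMeasure] {v : E → ℝ} (hv : Continuous v) {p : ℝ} (hp : 1 < p) (x y : E) {r : ℝ}
    (hr : 0 < r) :
    ‖v x‖ₑ ^ p ≤ 2 ^ (p - 1) * ((μ (ball y r))⁻¹ * ∫⁻ z in ball y r, ‖v x - v z‖ₑ ^ p ∂μ +
      ‖⨍ z in ball y r, v z ∂μ‖ₑ ^ p) := by
  have hpos : μ (ball y r) ≠ 0 := (measure_ball_pos μ y hr).ne'
  have hfin : μ (ball y r) ≠ ∞ := measure_ball_lt_top.ne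
  set ν := ((μ.restrict (ball y r)) univ)⁻¹ • μ.restrict (ball y r) with hν
  have hνp : IsProbabilityMeasure ν := by
    constructor
    simp [hν, ENNReal.inv_mul_cancel hpos hfin]
  have hint : Integrable v (μ.restrict (ball y r)) :=
    (hv.continuousOn.integrableOn_compact (isCompact_closedBall y r)).mono_set
      ball_subset_closedBall
  have hintν : Integrable v ν := hint.smul_measure (by simp [hpos])
  have havg : ⨍ z in ball y r, v z ∂μ = ∫ z, v z ∂ν := rfl
  have hdiff : v x - ∫ z, v z ∂ν = ∫ z, (v x - v z) ∂ν := by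
    rw [integral_sub (integrable_const _) hintν]
    simp
  have hJ : ‖v x - ∫ z, v z ∂ν‖ₑ ^ p ≤
      (μ (ball y r))⁻¹ * ∫⁻ z in ball y r, ‖v x - v z‖ₑ ^ p ∂μ := by
    rw [hdiff]
    calc ‖∫ z, (v x - v z) ∂ν‖ₑ ^ p ≤ (∫⁻ z, ‖v x - v z‖ₑ ∂ν) ^ p := by
          gcongr
          exact enorm_integral_le_lintegral_enorm _
      _ ≤ ν univ ^ (p - 1) * ∫⁻ z, ‖v x - v z‖ₑ ^ p ∂ν :=
          lintegral_rpow_le_measure_univ_mul _ hp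
            (continuous_const.sub hv).enorm.measurable.aemeasurable
      _ = _ := by
          rw [measure_univ, ENNReal.one_rpow, one_mul, hν, lintegral_smul_measure]
          simp
  rw [havg]
  calc ‖v x‖ₑ ^ p = ‖(v x - ∫ z, v z ∂ν) + ∫ z, v z ∂ν‖ₑ ^ p := by rw [sub_add_cancel]
    _ ≤ (‖v x - ∫ z, v z ∂ν‖ₑ + ‖∫ z, v z ∂ν‖ₑ) ^ p := by
        gcongr
        exact enorm_add_le _ _
    _ ≤ 2 ^ (p - 1) * (‖v x - ∫ z, v z ∂ν‖ₑ ^ p + ‖∫ z, v z ∂ν‖ₑ ^ p) :=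
        ENNReal.rpow_add_le_mul_rpow_add_rpow _ _ hp.le
    _ ≤ _ := by gcongr

variable {E : Type*} [NormedAddCommGroup E] [NormedSpace ℝ E]

lemma continuous_enorm_fderiv_rpow {v : E → ℝ} (hv : ContDiff ℝ 1 v) (p : ℝ) :
    Continuous fun x => ‖fderiv ℝ v x‖ₑ ^ p :=
  ENNReal.continuous_rpow_const.comp (hv.continuous_fderiv one_ne_zero).enorm

lemma enorm_sub_rpow_le_lintegral_segment {v : E → ℝ} (hv : ContDiff ℝ 1 v) {p : ℝ} (hp : 1 < p)
    (x e : E) {s : ℝ} (hs : 0 ≤ s) :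
    ‖v (x + s • e) - v x‖ₑ ^ p ≤ ENNReal.ofReal s ^ (p - 1) * ‖e‖ₑ ^ p *
      ∫⁻ τ in Ioc 0 s, ‖fderiv ℝ v (x + τ • e)‖ₑ ^ p := by
  have hp0 : 0 < p := by linarith
  have hcont : Continuous fun τ : ℝ => fderiv ℝ v (x + τ • e) :=
    (hv.continuous_fderiv one_ne_zero).comp (by fun_prop)
  have hder : ∀ τ : ℝ, HasDerivAt (fun τ : ℝ => v (x + τ • e)) (fderiv ℝ v (x + τ • e) e) τ := by
    intro τ
    have h1 : HasDerivAt (fun τ : ℝ => x + τ • e) e τ := by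
      simpa using ((hasDerivAt_id τ).smul_const e).const_add x
    exact ((hv.differentiable one_ne_zero) (x + τ • e)).hasFDerivAt.comp_hasDerivAt τ h1
  have hftc := intervalIntegral.integral_eq_sub_of_hasDerivAt (a := 0) (b := s)
    (fun τ _ => hder τ) ((hcont.clm_apply continuous_const).intervalIntegrable 0 s)
  simp only [zero_smul, add_zero] at hftc
  rw [← hftc, intervalIntegral.integral_of_le hs]
  calc ‖∫ τ in Ioc 0 s, fderiv ℝ v (x + τ • e) e‖ₑ ^ p
      ≤ (∫⁻ τ in Ioc 0 s, ‖fderiv ℝ v (x + τ • e)‖ₑ * ‖e‖ₑ) ^ p := by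
        gcongr
        refine (enorm_integral_le_lintegral_enorm _).trans (lintegral_mono fun τ => ?_)
        exact ContinuousLinearMap.le_opENorm _ _
    _ ≤ _ := by
      refine (lintegral_rpow_le_measure_univ_mul _ hp
        (hcont.enorm.measurable.mul_const _).aemeasurable).trans_eq ?_
      simp_rw [ENNReal.mul_rpow_of_nonneg _ _ hp0.le]
      rw [lintegral_mul_const _ (hcont.enorm.measurable.pow_const p)]
      simp
      ring

lemma lintegral_enorm_translate_sub_rpow_le [MeasurableSpace E] [BorelSpace E]
    [SecondCountableTopology E] (μ : Measure E)
    [SFinite μ] [μ.IsAddRightInvariant]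
    {v : E → ℝ} (hv : ContDiff ℝ 1 v) {p : ℝ} (hp : 1 < p) {K Ω : Set E} (hK : MeasurableSet K)
    (hΩ : MeasurableSet Ω) (e : E) {s : ℝ} (hs : 0 ≤ s)
    (hKΩ : ∀ τ ∈ Ioc 0 s, ∀ x ∈ K, x + τ • e ∈ Ω) :
    ∫⁻ x in K, ‖v (x + s • e) - v x‖ₑ ^ p ∂μ ≤
      ENNReal.ofReal s ^ p * ‖e‖ₑ ^ p * ∫⁻ x in Ω, ‖fderiv ℝ v x‖ₑ ^ p ∂μ := by
  set D := ∫⁻ x in Ω, ‖fderiv ℝ v x‖ₑ ^ p ∂μ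
  have hcd := continuous_enorm_fderiv_rpow hv p
  have hcd2 : Continuous fun q : E × ℝ => ‖fderiv ℝ v (q.1 + q.2 • e)‖ₑ ^ p :=
    hcd.comp (by fun_prop)
  have hslice : ∀ τ ∈ Ioc 0 s, ∫⁻ x in K, ‖fderiv ℝ v (x + τ • e)‖ₑ ^ p ∂μ ≤ D := by
    intro τ hτ
    calc ∫⁻ x in K, ‖fderiv ℝ v (x + τ • e)‖ₑ ^ p ∂μ
        ≤ ∫⁻ x, Ω.indicator (fun y => ‖fderiv ℝ v y‖ₑ ^ p) (x + τ • e) ∂μ := by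
          rw [← lintegral_indicator hK]
          refine lintegral_mono fun x => ?_
          by_cases hx : x ∈ K
          · rw [indicator_of_mem hx, indicator_of_mem (hKΩ τ hτ x hx)]
          · rw [indicator_of_notMem hx]
            exact zero_le
      _ = D := by
          rw [lintegral_add_right_eq_self (μ := μ)
            (Ω.indicator (fun y => ‖fderiv ℝ v y‖ₑ ^ p)) (τ • e), lintegral_indicator hΩ]
  calc ∫⁻ x in K, ‖v (x + s • e) - v x‖ₑ ^ p ∂μ
      ≤ ∫⁻ x in K, ENNReal.ofReal s ^ (p - 1) * ‖e‖ₑ ^ p *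
          (∫⁻ τ in Ioc 0 s, ‖fderiv ℝ v (x + τ • e)‖ₑ ^ p) ∂μ :=
        lintegral_mono fun x => enorm_sub_rpow_le_lintegral_segment hv hp x e hs
    _ = ENNReal.ofReal s ^ (p - 1) * ‖e‖ₑ ^ p *
          ∫⁻ τ in Ioc 0 s, (∫⁻ x in K, ‖fderiv ℝ v (x + τ • e)‖ₑ ^ p ∂μ) := by
        rw [lintegral_const_mul _ (Measurable.lintegral_prod_right' hcd2.measurable),
          lintegral_lintegral_swap hcd2.measurable.aemeasurable]
    _ ≤ ENNReal.ofReal s ^ (p - 1) * ‖e‖ₑ ^ p * ∫⁻ _ in Ioc (0 : ℝ) s, D := by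
        exact mul_le_mul' le_rfl (setLIntegral_mono' measurableSet_Ioc hslice)
    _ = ENNReal.ofReal s ^ p * ‖e‖ₑ ^ p * D := by
        rw [lintegral_const, Measure.restrict_apply_univ, Real.volume_Ioc, sub_zero]
        have : ENNReal.ofReal s ^ p = ENNReal.ofReal s ^ (p - 1) * ENNReal.ofReal s := by
          conv_lhs => rw [← sub_add_cancel p 1]
          rw [ENNReal.rpow_add_of_nonneg _ _ (by linarith) zero_le_one, ENNReal.rpow_one]
        rw [this]
        ring

variable [MeasurableSpace E]

/-- A functional `Q` on `C¹` functions is *compactly controlled* by the `W^{1,p}(Ω)` energy when,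
up to an arbitrarily small multiple of `∫_Ω |∇v|^p`, it is bounded by the averages of `v` over
finitely many balls contained in `Ω`. -/
def CompactlyControlled (μ : Measure E) (Ω : Set E) (p : ℝ) (Q : (E → ℝ) → ℝ≥0∞) : Prop :=
  ∀ η : ℝ≥0∞, η ≠ 0 → ∃ (T : Finset (E × ℝ)) (C : ℝ≥0∞), C ≠ ∞ ∧
    (∀ b ∈ T, 0 < b.2 ∧ ball b.1 b.2 ⊆ Ω) ∧
    ∀ v : E → ℝ, ContDiff ℝ 1 v →
      Q v ≤ C * ∑ b ∈ T, ‖⨍ y in ball b.1 b.2, v y ∂μ‖ₑ ^ p +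
        η * ∫⁻ x in Ω, ‖fderiv ℝ v x‖ₑ ^ p ∂μ

namespace CompactlyControlled

variable {μ : Measure E} {Ω : Set E} {p : ℝ} {Q Q' : (E → ℝ) → ℝ≥0∞}

lemma mono (h : CompactlyControlled μ Ω p Q) (hle : ∀ v, ContDiff ℝ 1 v → Q' v ≤ Q v) :
    CompactlyControlled μ Ω p Q' := by
  intro η hη
  obtain ⟨T, C, hC, hT, hb⟩ := h η hη
  exact ⟨T, C, hC, hT, fun v hv => (hle v hv).trans (hb v hv)⟩

/-- If `Q'` is bounded by multiples of `Q` up to small multiples of the energy, then it is compactly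
controlled as soon as `Q` is. -/
lemma of_interpolation (h : CompactlyControlled μ Ω p Q)
    (hle : ∀ η : ℝ≥0∞, η ≠ 0 → ∃ C : ℝ≥0∞, C ≠ ∞ ∧ ∀ v, ContDiff ℝ 1 v →
      Q' v ≤ C * Q v + η * ∫⁻ x in Ω, ‖fderiv ℝ v x‖ₑ ^ p ∂μ) :
    CompactlyControlled μ Ω p Q' := by
  intro η hη
  obtain ⟨C, hC, hQ⟩ := hle (η / 2) (by simp [hη])
  obtain ⟨T, C', hC', hT, hb⟩ := h (η / 2 / (C + 1))
    (ENNReal.div_ne_zero.2 ⟨by simp [hη], by simp [hC]⟩)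
  refine ⟨T, C * C', ENNReal.mul_ne_top hC hC', hT, fun v hv => ?_⟩
  set S := ∑ b ∈ T, ‖⨍ y in ball b.1 b.2, v y ∂μ‖ₑ ^ p
  set D := ∫⁻ x in Ω, ‖fderiv ℝ v x‖ₑ ^ p ∂μ
  have h1 : C * (η / 2 / (C + 1)) ≤ η / 2 := by
    calc C * (η / 2 / (C + 1)) ≤ (C + 1) * (η / 2 / (C + 1)) := by gcongr; simp
      _ ≤ η / 2 := ENNReal.mul_div_le
  calc Q' v ≤ C * Q v + η / 2 * D := hQ v hv
    _ ≤ C * (C' * S + η / 2 / (C + 1) * D) + η / 2 * D := by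
        gcongr
        exact hb v hv
    _ = C * C' * S + (C * (η / 2 / (C + 1)) * D + η / 2 * D) := by ring
    _ ≤ C * C' * S + (η / 2 * D + η / 2 * D) := by gcongr
    _ = C * C' * S + η * D := by rw [← add_mul, ENNReal.add_halves]

lemma add (h : CompactlyControlled μ Ω p Q) (h' : CompactlyControlled μ Ω p Q') :
    CompactlyControlled μ Ω p fun v => Q v + Q' v := by
  classical
  intro η hη
  obtain ⟨T, C, hC, hT, hb⟩ := h (η / 2) (by simp [hη])
  obtain ⟨T', C', hC', hT', hb'⟩ := h' (η / 2) (by simp [hη])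
  refine ⟨T ∪ T', C + C', by simp [hC, hC'], ?_, fun v hv => ?_⟩
  · intro b hb
    rcases Finset.mem_union.mp hb with hb | hb
    exacts [hT b hb, hT' b hb]
  set F : E × ℝ → ℝ≥0∞ := fun b => ‖⨍ y in ball b.1 b.2, v y ∂μ‖ₑ ^ p
  set D := ∫⁻ x in Ω, ‖fderiv ℝ v x‖ₑ ^ p ∂μ
  have h1 : ∑ b ∈ T, F b ≤ ∑ b ∈ T ∪ T', F b :=
    Finset.sum_le_sum_of_subset Finset.subset_union_left
  have h2 : ∑ b ∈ T', F b ≤ ∑ b ∈ T ∪ T', F b :=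
    Finset.sum_le_sum_of_subset Finset.subset_union_right
  calc Q v + Q' v ≤ (C * ∑ b ∈ T, F b + η / 2 * D) + (C' * ∑ b ∈ T', F b + η / 2 * D) :=
        add_le_add (hb v hv) (hb' v hv)
    _ ≤ (C * ∑ b ∈ T ∪ T', F b + η / 2 * D) + (C' * ∑ b ∈ T ∪ T', F b + η / 2 * D) := by gcongr
    _ = (C + C') * ∑ b ∈ T ∪ T', F b + (η / 2 + η / 2) * D := by ring
    _ = _ := by rw [ENNReal.add_halves]

lemma sum {ι : Type*} (s : Finset ι) {Q : ι → (E → ℝ) → ℝ≥0∞}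
    (h : ∀ i ∈ s, CompactlyControlled μ Ω p (Q i)) :
    CompactlyControlled μ Ω p fun v => ∑ i ∈ s, Q i v := by
  classical
  induction s using Finset.induction_on with
  | empty =>
    intro η hη
    exact ⟨∅, 0, by simp, by simp, by simp⟩
  | insert a s ha ih =>
    simp_rw [Finset.sum_insert ha]
    exact (h a (Finset.mem_insert_self a s)).add
      (ih fun i hi => h i (Finset.mem_insert_of_mem hi))

end CompactlyControlled

variable [BorelSpace E] [FiniteDimensional ℝ E] (μ : Measure E) [μ.IsAddHaarMeasure]
  {Ω K : Set E} {p : ℝ}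

/-- Interior compactness: the `L^p` norm on a compact subset is compactly controlled. -/
lemma compactlyControlled_of_isCompact_subset (hp : 1 < p) (hΩ : IsOpen Ω) (hK : IsCompact K)
    (hKΩ : K ⊆ Ω) :
    CompactlyControlled μ Ω p fun v => ∫⁻ x in K, ‖v x‖ₑ ^ p ∂μ := by
  have hp0 : 0 < p := by linarith
  intro η hη
  obtain ⟨δ, hδ, hthick⟩ := hK.exists_thickening_subset_open hΩ hKΩ
  set n := Module.finrank ℝ E
  obtain ⟨r₀, hr₀, hsmall⟩ := exists_pos_mul_ofReal_rpow_le
    (A := 2 ^ (p - 1) * (ENNReal.ofReal (2 ^ n) * 2 ^ p)) (η := η)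
    (ENNReal.mul_ne_top (by simp)
      (ENNReal.mul_ne_top (by simp) (ENNReal.rpow_ne_top_of_nonneg hp0.le (by simp)))) hη hp0
  set r := min r₀ (δ / 2) with hrdef
  have hr : 0 < r := lt_min hr₀ (by positivity)
  have hrδ : 2 * r ≤ δ := by
    have : r ≤ δ / 2 := min_le_right _ _
    linarith
  obtain ⟨t, htK, htfin, hcover⟩ := hK.finite_cover_balls hr
  classical
  have hinj : Function.Injective fun y : E => (y, r) := fun a b h => (Prod.ext_iff.mp h).1
  refine ⟨htfin.toFinset.map ⟨_, hinj⟩, 2 ^ (p - 1) * μ K,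
    ENNReal.mul_ne_top (by simp) hK.measure_lt_top.ne, ?_, fun v hv => ?_⟩
  · intro b hb
    obtain ⟨y, hy, rfl⟩ := Finset.mem_map.mp hb
    refine ⟨hr, fun z hz => hthick ?_⟩
    rw [mem_thickening_iff]
    refine ⟨y, htK (by simpa using hy), ?_⟩
    have := mem_ball.mp hz
    simp only [Function.Embedding.coeFn_mk] at this
    linarith
  rw [Finset.sum_map]
  simp only [Function.Embedding.coeFn_mk]
  set D := ∫⁻ x in Ω, ‖fderiv ℝ v x‖ₑ ^ p ∂μ
  set S := ∑ y ∈ htfin.toFinset, ‖⨍ z in ball y r, v z ∂μ‖ₑ ^ p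
  set G : E → E → ℝ≥0∞ := fun x z => ‖v (x + (1 : ℝ) • z) - v x‖ₑ ^ p with hG
  have hvc := hv.continuous
  have hGc : Continuous (Function.uncurry G) := by
    refine ENNReal.continuous_rpow_const.comp (Continuous.enorm ?_)
    fun_prop
  have hpt : ∀ x ∈ K, ‖v x‖ₑ ^ p ≤
      2 ^ (p - 1) * ((μ (ball 0 r))⁻¹ * ∫⁻ z in ball 0 (2 * r), G x z ∂μ + S) := by
    intro x hx
    obtain ⟨y, hy, hxy⟩ : ∃ y ∈ t, x ∈ ball y r := by simpa using hcover hx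
    refine (enorm_rpow_le_average μ hvc hp x y hr).trans ?_
    rw [Measure.addHaar_ball_center]
    have h1 : ∫⁻ z in ball y r, ‖v x - v z‖ₑ ^ p ∂μ ≤ ∫⁻ z in ball 0 (2 * r), G x z ∂μ := by
      rw [← lintegral_indicator measurableSet_ball, ← lintegral_indicator measurableSet_ball,
        ← lintegral_add_left_eq_self _ x]
      refine lintegral_mono fun z => ?_
      by_cases hz : x + z ∈ ball y r
      · have hz' : z ∈ ball (0 : E) (2 * r) := by
          rw [mem_ball_zero_iff]
          have h3 : z = (x + z - y) - (x - y) := by abel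
          have h4 := mem_ball_iff_norm.mp hz
          have h5 := mem_ball_iff_norm.mp hxy
          calc ‖z‖ = ‖(x + z - y) - (x - y)‖ := by rw [← h3]
            _ ≤ ‖x + z - y‖ + ‖x - y‖ := norm_sub_le _ _
            _ < 2 * r := by linarith
        rw [indicator_of_mem hz, indicator_of_mem hz', hG]
        simp only [one_smul]
        rw [← enorm_neg, neg_sub]
      · rw [indicator_of_notMem hz]
        exact zero_le
    have h2 : ‖⨍ z in ball y r, v z ∂μ‖ₑ ^ p ≤ S :=
      Finset.single_le_sum (f := fun y => ‖⨍ z in ball y r, v z ∂μ‖ₑ ^ p)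
        (fun _ _ => zero_le) (by simpa using hy)
    gcongr
  have hGint : ∫⁻ x in K, ∫⁻ z in ball 0 (2 * r), G x z ∂μ ∂μ ≤
      (ENNReal.ofReal (2 * r) ^ p * D) * μ (ball 0 (2 * r)) := by
    rw [lintegral_lintegral_swap hGc.measurable.aemeasurable,
      ← Measure.restrict_apply_univ (μ := μ) (ball 0 (2 * r)), ← lintegral_const]
    refine setLIntegral_mono' measurableSet_ball fun z hz => ?_
    refine (lintegral_enorm_translate_sub_rpow_le μ hv hp hK.measurableSet hΩ.measurableSet z
      zero_le_one ?_).trans ?_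
    · intro τ hτ x hx
      refine hthick (mem_thickening_iff.mpr ⟨x, hx, ?_⟩)
      rw [mem_ball_zero_iff] at hz
      rw [dist_eq_norm, add_sub_cancel_left, norm_smul, Real.norm_of_nonneg hτ.1.le]
      calc τ * ‖z‖ ≤ 1 * ‖z‖ := by gcongr; exact hτ.2
        _ < δ := by linarith
    · rw [ENNReal.ofReal_one, ENNReal.one_rpow, one_mul]
      gcongr
      rw [mem_ball_zero_iff] at hz
      rw [← ofReal_norm]
      exact ENNReal.ofReal_le_ofReal hz.le
  have hbr : μ (ball (0 : E) r) ≠ 0 := (measure_ball_pos μ 0 hr).ne'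
  have hbr' : μ (ball (0 : E) r) ≠ ∞ := measure_ball_lt_top.ne
  calc ∫⁻ x in K, ‖v x‖ₑ ^ p ∂μ
      ≤ ∫⁻ x in K, 2 ^ (p - 1) * ((μ (ball 0 r))⁻¹ * ∫⁻ z in ball 0 (2 * r), G x z ∂μ + S) ∂μ :=
        setLIntegral_mono' hK.measurableSet hpt
    _ = 2 ^ (p - 1) * ((μ (ball 0 r))⁻¹ * (∫⁻ x in K, ∫⁻ z in ball 0 (2 * r), G x z ∂μ ∂μ) +
          S * μ K) := by
        have hm : Measurable fun x => ∫⁻ z in ball 0 (2 * r), G x z ∂μ :=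
          Measurable.lintegral_prod_right' hGc.measurable
        rw [lintegral_const_mul _ ((hm.const_mul _).add_const _),
          lintegral_add_right _ measurable_const, lintegral_const_mul _ hm, lintegral_const,
          Measure.restrict_apply_univ]
    _ ≤ 2 ^ (p - 1) * ((μ (ball 0 r))⁻¹ * ((ENNReal.ofReal (2 * r) ^ p * D) *
          μ (ball 0 (2 * r))) + S * μ K) := by gcongr
    _ = 2 ^ (p - 1) * μ K * S + 2 ^ (p - 1) * (ENNReal.ofReal (2 ^ n) * 2 ^ p) *
          ENNReal.ofReal r ^ p * D * ((μ (ball 0 r))⁻¹ * μ (ball 0 r)) := by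
        rw [Measure.addHaar_ball_mul_of_pos μ 0 (by norm_num : (0 : ℝ) < 2) r,
          ENNReal.ofReal_mul zero_le_two, ENNReal.mul_rpow_of_nonneg _ _ hp0.le]
        simp only [ENNReal.ofReal_ofNat]
        ring
    _ ≤ _ := by
        rw [ENNReal.inv_mul_cancel hbr hbr', mul_one]
        gcongr
        exact hsmall r hr (min_le_left _ _)

/-- The `L^p` norm on a compact set that can be pushed into `Ω` along a direction `e` is compactly
controlled. -/
lemma compactlyControlled_of_translate_subset (hp : 1 < p) (hΩ : IsOpen Ω) (hK : IsCompact K)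
    (e : E) {s₀ : ℝ} (hs₀ : 0 < s₀) (hKΩ : ∀ τ ∈ Ioc 0 s₀, ∀ x ∈ K, x + τ • e ∈ Ω) :
    CompactlyControlled μ Ω p fun v => ∫⁻ x in K, ‖v x‖ₑ ^ p ∂μ := by
  have hp0 : 0 < p := by linarith
  intro η hη
  have hA : (2 : ℝ≥0∞) ^ (p - 1) ≠ ∞ := by simp
  obtain ⟨r₀, hr₀, hsmall⟩ := exists_pos_mul_ofReal_rpow_le
    (A := 2 ^ (p - 1) * ‖e‖ₑ ^ p) (η := η / 2)
    (ENNReal.mul_ne_top hA (ENNReal.rpow_ne_top_of_nonneg hp0.le enorm_ne_top)) (by simp [hη]) hp0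
  set s := min r₀ s₀
  have hs : 0 < s := lt_min hr₀ hs₀
  set K' := (fun x => x + s • e) '' K with hK'
  have hK'c : IsCompact K' := hK.image (by fun_prop)
  have hK'Ω : K' ⊆ Ω := by
    rintro _ ⟨x, hx, rfl⟩
    exact hKΩ s ⟨hs, min_le_right _ _⟩ x hx
  have hctrl := compactlyControlled_of_isCompact_subset μ hp hΩ hK'c hK'Ω
  obtain ⟨T, C, hC, hT, hb⟩ := hctrl (η / 2 / 2 ^ (p - 1))
    (ENNReal.div_ne_zero.2 ⟨by simp [hη], hA⟩)
  refine ⟨T, 2 ^ (p - 1) * C, ENNReal.mul_ne_top hA hC, hT, fun v hv => ?_⟩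
  set S := ∑ b ∈ T, ‖⨍ y in ball b.1 b.2, v y ∂μ‖ₑ ^ p
  set D := ∫⁻ x in Ω, ‖fderiv ℝ v x‖ₑ ^ p ∂μ
  have hvc := hv.continuous
  have hshift : ∫⁻ x in K, ‖v (x + s • e)‖ₑ ^ p ∂μ ≤ ∫⁻ x in K', ‖v x‖ₑ ^ p ∂μ := by
    rw [← lintegral_indicator hK.measurableSet, ← lintegral_indicator hK'c.measurableSet,
      ← lintegral_add_right_eq_self (K'.indicator _) (s • e)]
    refine lintegral_mono fun x => ?_
    by_cases hx : x ∈ K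
    · rw [indicator_of_mem hx, indicator_of_mem (mem_image_of_mem _ hx)]
    · rw [indicator_of_notMem hx]
      exact zero_le
  have htrans := lintegral_enorm_translate_sub_rpow_le μ hv hp hK.measurableSet hΩ.measurableSet e
    hs.le (fun τ hτ => hKΩ τ ⟨hτ.1, hτ.2.trans (min_le_right _ _)⟩)
  have hm : Measurable fun x => ‖v (x + s • e) - v x‖ₑ ^ p := by
    refine (ENNReal.continuous_rpow_const.comp (Continuous.enorm ?_)).measurable
    fun_prop
  calc ∫⁻ x in K, ‖v x‖ₑ ^ p ∂μ
      ≤ ∫⁻ x in K, 2 ^ (p - 1) * (‖v (x + s • e) - v x‖ₑ ^ p + ‖v (x + s • e)‖ₑ ^ p) ∂μ := by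
        refine lintegral_mono fun x => ?_
        refine le_trans ?_ (ENNReal.rpow_add_le_mul_rpow_add_rpow _ _ hp.le)
        gcongr
        rw [← enorm_neg (v (x + s • e) - v x)]
        refine le_trans (le_of_eq ?_) (enorm_add_le _ _)
        congr 1
        ring
    _ = 2 ^ (p - 1) * (∫⁻ x in K, ‖v (x + s • e) - v x‖ₑ ^ p ∂μ +
          ∫⁻ x in K, ‖v (x + s • e)‖ₑ ^ p ∂μ) := by
        rw [lintegral_const_mul' _ _ hA, lintegral_add_left hm]
    _ ≤ 2 ^ (p - 1) * (ENNReal.ofReal s ^ p * ‖e‖ₑ ^ p * D +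
          (C * S + η / 2 / 2 ^ (p - 1) * D)) := by
        gcongr
        exact hshift.trans (hb v hv)
    _ = 2 ^ (p - 1) * C * S + (2 ^ (p - 1) * ‖e‖ₑ ^ p * ENNReal.ofReal s ^ p * D +
          2 ^ (p - 1) * (η / 2 / 2 ^ (p - 1)) * D) := by ring
    _ ≤ 2 ^ (p - 1) * C * S + (η / 2 * D + η / 2 * D) := by
        gcongr
        · exact hsmall s hs (min_le_left _ _)
        · exact ENNReal.mul_div_le
    _ = 2 ^ (p - 1) * C * S + η * D := by rw [← add_mul, ENNReal.add_halves]

end Control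

section Trace

variable {m : ℕ}

/-- The projection of `ℝ^{m+1}` onto `ℝ^m` forgetting the `i`-th coordinate. -/
def forgetCoord (i : Fin (m + 1)) (x : EuclideanSpace ℝ (Fin (m + 1))) : Fin m → ℝ :=
  fun j => x (i.succAbove j)

/-- The point of `ℝ^{m+1}` with `i`-th coordinate `z` and remaining coordinates `y`. -/
def insertCoord (i : Fin (m + 1)) (z : ℝ) (y : Fin m → ℝ) : EuclideanSpace ℝ (Fin (m + 1)) :=
  WithLp.toLp 2 (i.insertNth z y)

lemma measurable_forgetCoord (i : Fin (m + 1)) : Measurable (forgetCoord i) := by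
  unfold forgetCoord
  fun_prop

lemma measurable_insertCoord (i : Fin (m + 1)) :
    Measurable fun q : (Fin m → ℝ) × ℝ => insertCoord i q.2 q.1 := by
  have h : Measurable fun q : (Fin m → ℝ) × ℝ =>
      (MeasurableEquiv.piFinSuccAbove (fun _ => ℝ) i).symm (q.2, q.1) :=
    (MeasurableEquiv.measurable _).comp (measurable_snd.prodMk measurable_fst)
  exact (WithLp.measurable_toLp 2 (Fin (m + 1) → ℝ)).comp h

lemma lintegral_lintegral_insertCoord (i : Fin (m + 1))
    {F : EuclideanSpace ℝ (Fin (m + 1)) → ℝ≥0∞} (hF : Measurable F) :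
    ∫⁻ y, ∫⁻ z, F (insertCoord i z y) = ∫⁻ x, F x := by
  have h1 := (EuclideanSpace.volume_preserving_symm_measurableEquiv_toLp (Fin (m + 1))).symm
  have h2 := (volume_preserving_piFinSuccAbove (fun _ : Fin (m + 1) => ℝ) i).symm
  have h3 : Measurable fun a : Fin (m + 1) → ℝ =>
      F ((MeasurableEquiv.toLp 2 (Fin (m + 1) → ℝ)).symm.symm a) :=
    hF.comp (MeasurableEquiv.measurable _)
  rw [← h1.lintegral_comp hF, ← h2.lintegral_comp h3, Measure.volume_eq_prod]
  exact (lintegral_prod_symm' _ (h3.comp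
    (MeasurableEquiv.piFinSuccAbove (fun _ => ℝ) i).symm.measurable)).symm

lemma lintegral_line_eq (i : Fin (m + 1)) {σ : ℝ} (hσ : σ = 1 ∨ σ = -1)
    (F : EuclideanSpace ℝ (Fin (m + 1)) → ℝ≥0∞) (x : EuclideanSpace ℝ (Fin (m + 1))) :
    ∫⁻ τ : ℝ, F (x + τ • σ • EuclideanSpace.single i (1 : ℝ)) =
      ∫⁻ z, F (insertCoord i z (forgetCoord i x)) := by
  have hpt : ∀ τ : ℝ, x + τ • σ • EuclideanSpace.single i (1 : ℝ) =
      insertCoord i (x i + τ * σ) (forgetCoord i x) := by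
    intro τ
    ext j
    refine Fin.succAboveCases i ?_ (fun k => ?_) j
    · simp [insertCoord]
    · simp [insertCoord, forgetCoord, Fin.succAbove_ne]
  simp_rw [hpt]
  rcases hσ with rfl | rfl
  · simp_rw [mul_one]
    exact lintegral_add_left_eq_self (fun z => F (insertCoord i z (forgetCoord i x))) (x i)
  · simp_rw [mul_neg_one, ← sub_eq_add_neg]
    exact lintegral_sub_left_eq_self (fun z => F (insertCoord i z (forgetCoord i x))) (x i)

lemma dist_le_mul_dist_forgetCoord (i : Fin (m + 1)) {L : ℝ}
    {x y : EuclideanSpace ℝ (Fin (m + 1))}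
    (h : |x i - y i| ≤ L * dist (forgetCoord i x) (forgetCoord i y)) :
    dist x y ≤ (L + m) * dist (forgetCoord i x) (forgetCoord i y) := by
  have h1 : dist x y ≤ ∑ j, |x j - y j| := by
    rw [EuclideanSpace.dist_eq]
    simp_rw [Real.dist_eq]
    exact Real.sqrt_le_iff.mpr ⟨by positivity,
      Finset.sum_sq_le_sq_sum_of_nonneg fun j _ => abs_nonneg _⟩
  have h2 : ∑ k : Fin m, |x (i.succAbove k) - y (i.succAbove k)| ≤
      ∑ _k : Fin m, dist (forgetCoord i x) (forgetCoord i y) :=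
    Finset.sum_le_sum fun k _ => dist_le_pi_dist (forgetCoord i x) (forgetCoord i y) k
  rw [Fin.sum_univ_succAbove _ i] at h1
  simp at h2
  linarith

/-- The surface integral over a Lipschitz graph in direction `i` is controlled by the integral over
the base. -/
lemma exists_lintegral_graph_le (i : Fin (m + 1)) {S : Set (EuclideanSpace ℝ (Fin (m + 1)))}
    {L : ℝ} (hL : 0 ≤ L)
    (hS : ∀ x ∈ S, ∀ y ∈ S, |x i - y i| ≤ L * dist (forgetCoord i x) (forgetCoord i y)) :
    ∃ C : ℝ≥0∞, C ≠ ∞ ∧ ∀ H : (Fin m → ℝ) → ℝ≥0∞, Measurable H →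
      ∫⁻ x in S, H (forgetCoord i x) ∂(μH[(m : ℝ)]) ≤ C * ∫⁻ y, H y := by
  set K : ℝ≥0 := ⟨L + m, by positivity⟩
  refine ⟨(K : ℝ≥0∞) ^ (m : ℝ), by simp, fun H hH => ?_⟩
  have hP := measurable_forgetCoord i
  have hanti : ∀ x ∈ S, ∀ y ∈ S, dist x y ≤ K * dist (forgetCoord i x) (forgetCoord i y) :=
    fun x hx y hy => dist_le_mul_dist_forgetCoord i (hS x hx y hy)
  have hmap : Measure.map (forgetCoord i) ((μH[(m : ℝ)]).restrict S) ≤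
      (K : ℝ≥0∞) ^ (m : ℝ) • (volume : Measure (Fin m → ℝ)) := by
    refine Measure.le_iff.mpr fun A hA => ?_
    rw [Measure.map_apply hP hA, Measure.restrict_apply (hP hA), Measure.smul_apply, smul_eq_mul]
    set g := Function.invFunOn (forgetCoord i) S
    have hg : ∀ x ∈ S, g (forgetCoord i x) = x := by
      intro x hx
      have h1 : forgetCoord i x ∈ forgetCoord i '' S := mem_image_of_mem _ hx
      have h2 := Function.invFunOn_mem h1
      have h3 := Function.invFunOn_eq h1
      have h4 := hanti _ h2 _ hx
      rw [h3, dist_self, mul_zero] at h4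
      exact dist_le_zero.mp h4
    have hlip : LipschitzOnWith K g (A ∩ forgetCoord i '' S) := by
      refine LipschitzOnWith.of_dist_le_mul ?_
      rintro _ ⟨-, x, hx, rfl⟩ _ ⟨-, y, hy, rfl⟩
      rw [hg x hx, hg y hy]
      exact hanti x hx y hy
    have hsub : forgetCoord i ⁻¹' A ∩ S ⊆ g '' (A ∩ forgetCoord i '' S) := by
      rintro x ⟨hxA, hxS⟩
      exact ⟨forgetCoord i x, ⟨hxA, mem_image_of_mem _ hxS⟩, hg x hxS⟩
    calc μH[(m : ℝ)] (forgetCoord i ⁻¹' A ∩ S)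
        ≤ μH[(m : ℝ)] (g '' (A ∩ forgetCoord i '' S)) := measure_mono hsub
      _ ≤ (K : ℝ≥0∞) ^ (m : ℝ) * μH[(m : ℝ)] (A ∩ forgetCoord i '' S) :=
          hlip.hausdorffMeasure_image_le (Nat.cast_nonneg m)
      _ ≤ (K : ℝ≥0∞) ^ (m : ℝ) * μH[(m : ℝ)] A := by
          gcongr
          exact inter_subset_left
      _ = (K : ℝ≥0∞) ^ (m : ℝ) * volume A := by
          rw [← hausdorffMeasure_pi_real, Fintype.card_fin]
  calc ∫⁻ x in S, H (forgetCoord i x) ∂(μH[(m : ℝ)])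
      = ∫⁻ y, H y ∂(Measure.map (forgetCoord i) ((μH[(m : ℝ)]).restrict S)) :=
        (lintegral_map hH hP).symm
    _ ≤ ∫⁻ y, H y ∂((K : ℝ≥0∞) ^ (m : ℝ) • (volume : Measure (Fin m → ℝ))) :=
        lintegral_mono' hmap le_rfl
    _ = _ := by rw [lintegral_smul_measure, smul_eq_mul]

lemma ofReal_mul_enorm_rpow_le {E : Type*} [NormedAddCommGroup E] [NormedSpace ℝ E] {v : E → ℝ}
    (hv : ContDiff ℝ 1 v) {p : ℝ} (hp : 1 < p) (x e : E) (he : ‖e‖ ≤ 1) {w ε : ℝ} (hw0 : 0 ≤ w)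
    (hw1 : w ≤ 1) (hε : 0 < ε) :
    ENNReal.ofReal w * ‖v x‖ₑ ^ p ≤ 2 ^ (p - 1) *
      ((ENNReal.ofReal ε)⁻¹ * (∫⁻ τ in Ioc 0 (ε * w), ‖v (x + τ • e)‖ₑ ^ p) +
        ENNReal.ofReal ε ^ (p - 1) *
          ∫⁻ τ in Ioc 0 (ε * w), ‖fderiv ℝ v (x + τ • e)‖ₑ ^ p) := by
  have hp0 : 0 < p := by linarith
  set l := ε * w with hl
  have hl0 : 0 ≤ l := by positivity
  have hlε : l ≤ ε := by nlinarith
  set J := ∫⁻ τ in Ioc 0 l, ‖fderiv ℝ v (x + τ • e)‖ₑ ^ p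
  have hvc := hv.continuous
  have hA : (2 : ℝ≥0∞) ^ (p - 1) ≠ ∞ := by simp
  have hm : Measurable fun τ : ℝ => ‖v (x + τ • e)‖ₑ ^ p := by
    refine (ENNReal.continuous_rpow_const.comp (Continuous.enorm ?_)).measurable
    fun_prop
  have he' : ‖e‖ₑ ^ p ≤ 1 := by
    refine (ENNReal.rpow_le_rpow (z := p) ?_ hp0.le).trans_eq (ENNReal.one_rpow p)
    rw [← ofReal_norm]
    exact ENNReal.ofReal_le_one.mpr he
  have hpt : ∀ τ ∈ Ioc 0 l, ‖v x‖ₑ ^ p ≤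
      2 ^ (p - 1) * (‖v (x + τ • e)‖ₑ ^ p + ENNReal.ofReal ε ^ (p - 1) * J) := by
    intro τ hτ
    have h1 : ‖v x‖ₑ ≤ ‖v (x + τ • e)‖ₑ + ‖v (x + τ • e) - v x‖ₑ := by
      rw [← enorm_neg (v (x + τ • e) - v x)]
      refine le_trans (le_of_eq ?_) (enorm_add_le _ _)
      congr 1
      ring
    refine ((ENNReal.rpow_le_rpow h1 hp0.le).trans
      (ENNReal.rpow_add_le_mul_rpow_add_rpow _ _ hp.le)).trans ?_
    gcongr
    calc ‖v (x + τ • e) - v x‖ₑ ^ p ≤ ENNReal.ofReal τ ^ (p - 1) * ‖e‖ₑ ^ p *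
          ∫⁻ t in Ioc 0 τ, ‖fderiv ℝ v (x + t • e)‖ₑ ^ p :=
          enorm_sub_rpow_le_lintegral_segment hv hp x e hτ.1.le
      _ ≤ ENNReal.ofReal ε ^ (p - 1) * 1 * J := by
          have h3 : ENNReal.ofReal τ ^ (p - 1) ≤ ENNReal.ofReal ε ^ (p - 1) :=
            ENNReal.rpow_le_rpow (ENNReal.ofReal_le_ofReal (hτ.2.trans hlε)) (by linarith)
          have h4 : ∫⁻ t in Ioc 0 τ, ‖fderiv ℝ v (x + t • e)‖ₑ ^ p ≤ J :=
            lintegral_mono_set (Ioc_subset_Ioc_right hτ.2)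
          exact mul_le_mul' (mul_le_mul' h3 he') h4
      _ = _ := by rw [mul_one]
  have hint : ENNReal.ofReal l * ‖v x‖ₑ ^ p ≤ 2 ^ (p - 1) *
      ((∫⁻ τ in Ioc 0 l, ‖v (x + τ • e)‖ₑ ^ p) +
        ENNReal.ofReal ε ^ (p - 1) * J * ENNReal.ofReal l) := by
    have := setLIntegral_mono' (μ := volume) measurableSet_Ioc hpt
    rw [lintegral_const, Measure.restrict_apply_univ, Real.volume_Ioc, sub_zero,
      lintegral_const_mul' _ _ hA, lintegral_add_left hm, lintegral_const,
      Measure.restrict_apply_univ, Real.volume_Ioc, sub_zero] at this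
    rwa [mul_comm]
  have hε0 : ENNReal.ofReal ε ≠ 0 := by simpa using hε
  have hw : ENNReal.ofReal w = (ENNReal.ofReal ε)⁻¹ * ENNReal.ofReal l := by
    rw [hl, ENNReal.ofReal_mul hε.le, ← mul_assoc,
      ENNReal.inv_mul_cancel hε0 ENNReal.ofReal_ne_top, one_mul]
  calc ENNReal.ofReal w * ‖v x‖ₑ ^ p
      = (ENNReal.ofReal ε)⁻¹ * (ENNReal.ofReal l * ‖v x‖ₑ ^ p) := by rw [hw, mul_assoc]
    _ ≤ (ENNReal.ofReal ε)⁻¹ * (2 ^ (p - 1) *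
      ((∫⁻ τ in Ioc 0 l, ‖v (x + τ • e)‖ₑ ^ p) +
        ENNReal.ofReal ε ^ (p - 1) * J * ENNReal.ofReal l)) := by gcongr
    _ = 2 ^ (p - 1) * ((ENNReal.ofReal ε)⁻¹ * (∫⁻ τ in Ioc 0 l, ‖v (x + τ • e)‖ₑ ^ p) +
        ENNReal.ofReal ε ^ (p - 1) * J * ((ENNReal.ofReal ε)⁻¹ * ENNReal.ofReal l)) := by ring
    _ ≤ 2 ^ (p - 1) * ((ENNReal.ofReal ε)⁻¹ * (∫⁻ τ in Ioc 0 l, ‖v (x + τ • e)‖ₑ ^ p) +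
        ENNReal.ofReal ε ^ (p - 1) * J * 1) := by
        rw [← hw]
        gcongr
        exact ENNReal.ofReal_le_one.mpr hw1
    _ = _ := by rw [mul_one]

/-- The weighted trace on a Lipschitz graph piece of the boundary is compactly controlled, provided
inward segments of length comparable to the weight stay in the domain. -/
lemma compactlyControlled_graph {Ω S : Set (EuclideanSpace ℝ (Fin (m + 1)))} {p : ℝ} (hp : 1 < p)
    (hΩ : MeasurableSet Ω)
    (hI : CompactlyControlled volume Ω p fun v => ∫⁻ x in Ω, ‖v x‖ₑ ^ p)
    (hSm : MeasurableSet S) (i : Fin (m + 1)) {σ : ℝ} (hσ : σ = 1 ∨ σ = -1) {L : ℝ} (hL : 0 ≤ L)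
    (hS : ∀ x ∈ S, ∀ y ∈ S, |x i - y i| ≤ L * dist (forgetCoord i x) (forgetCoord i y))
    {w : EuclideanSpace ℝ (Fin (m + 1)) → ℝ} (hw0 : ∀ x ∈ S, 0 ≤ w x) (hw1 : ∀ x ∈ S, w x ≤ 1)
    {ε₀ : ℝ} (hε₀ : 0 < ε₀)
    (hseg : ∀ x ∈ S, ∀ τ ∈ Ioc 0 (ε₀ * w x),
      x + τ • σ • EuclideanSpace.single i (1 : ℝ) ∈ Ω) :
    CompactlyControlled volume Ω p fun v =>
      ∫⁻ x in S, ENNReal.ofReal (w x) * ‖v x‖ₑ ^ p ∂(μH[(m : ℝ)]) := by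
  refine hI.of_interpolation fun η hη => ?_
  obtain ⟨C, hC, hCb⟩ := exists_lintegral_graph_le i hL hS
  have hA : (2 : ℝ≥0∞) ^ (p - 1) ≠ ∞ := by simp
  obtain ⟨r₀, hr₀, hsmall⟩ := exists_pos_mul_ofReal_rpow_le (A := C * 2 ^ (p - 1))
    (ENNReal.mul_ne_top hC hA) hη (q := p - 1) (by linarith)
  set ε := min r₀ ε₀
  have hε : 0 < ε := lt_min hr₀ hε₀
  have hε0 : ENNReal.ofReal ε ≠ 0 := by simpa using hε
  refine ⟨C * 2 ^ (p - 1) * (ENNReal.ofReal ε)⁻¹,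
    ENNReal.mul_ne_top (ENNReal.mul_ne_top hC hA) (ENNReal.inv_ne_top.mpr hε0), fun v hv => ?_⟩
  set e : EuclideanSpace ℝ (Fin (m + 1)) := σ • EuclideanSpace.single i (1 : ℝ) with hedef
  have he : ‖e‖ ≤ 1 := by
    rcases hσ with h | h <;> simp [hedef, h]
  set F₀ : EuclideanSpace ℝ (Fin (m + 1)) → ℝ≥0∞ := Ω.indicator fun x => ‖v x‖ₑ ^ p
  set F₁ : EuclideanSpace ℝ (Fin (m + 1)) → ℝ≥0∞ := Ω.indicator fun x => ‖fderiv ℝ v x‖ₑ ^ p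
  have hF₀ : Measurable F₀ :=
    (ENNReal.continuous_rpow_const.comp hv.continuous.enorm).measurable.indicator hΩ
  have hF₁ : Measurable F₁ := (continuous_enorm_fderiv_rpow hv p).measurable.indicator hΩ
  have hslice : ∀ F : EuclideanSpace ℝ (Fin (m + 1)) → ℝ≥0∞, ∀ x ∈ S,
      ∫⁻ τ in Ioc 0 (ε * w x), F (x + τ • e) ≤
        ∫⁻ z, Ω.indicator F (insertCoord i z (forgetCoord i x)) := by
    intro F x hx
    rw [← lintegral_line_eq i hσ, ← lintegral_indicator measurableSet_Ioc]
    refine lintegral_mono fun τ => ?_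
    by_cases hτ : τ ∈ Ioc 0 (ε * w x)
    · have hτ' : τ ∈ Ioc 0 (ε₀ * w x) :=
        ⟨hτ.1, hτ.2.trans (mul_le_mul_of_nonneg_right (min_le_right _ _) (hw0 x hx))⟩
      rw [indicator_of_mem hτ, indicator_of_mem (hseg x hx τ hτ')]
    · rw [indicator_of_notMem hτ]
      exact zero_le
  set H : (Fin m → ℝ) → ℝ≥0∞ := fun y => 2 ^ (p - 1) *
    ((ENNReal.ofReal ε)⁻¹ * (∫⁻ z, F₀ (insertCoord i z y)) +
      ENNReal.ofReal ε ^ (p - 1) * ∫⁻ z, F₁ (insertCoord i z y)) with hH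
  have hm₀ : Measurable fun y : Fin m → ℝ => ∫⁻ z, F₀ (insertCoord i z y) :=
    Measurable.lintegral_prod_right' (hF₀.comp (measurable_insertCoord i))
  have hm₁ : Measurable fun y : Fin m → ℝ => ∫⁻ z, F₁ (insertCoord i z y) :=
    Measurable.lintegral_prod_right' (hF₁.comp (measurable_insertCoord i))
  have hHm : Measurable H := ((hm₀.const_mul _).add (hm₁.const_mul _)).const_mul _
  calc ∫⁻ x in S, ENNReal.ofReal (w x) * ‖v x‖ₑ ^ p ∂(μH[(m : ℝ)])
      ≤ ∫⁻ x in S, H (forgetCoord i x) ∂(μH[(m : ℝ)]) := by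
        refine setLIntegral_mono' hSm fun x hx => ?_
        refine (ofReal_mul_enorm_rpow_le hv hp x e he (hw0 x hx) (hw1 x hx) hε).trans ?_
        have h₀ := hslice (fun x => ‖v x‖ₑ ^ p) x hx
        have h₁ := hslice (fun x => ‖fderiv ℝ v x‖ₑ ^ p) x hx
        exact mul_le_mul' le_rfl (add_le_add (mul_le_mul' le_rfl h₀) (mul_le_mul' le_rfl h₁))
    _ ≤ C * ∫⁻ y, H y := hCb H hHm
    _ = C * (2 ^ (p - 1) * ((ENNReal.ofReal ε)⁻¹ * (∫⁻ x in Ω, ‖v x‖ₑ ^ p) +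
          ENNReal.ofReal ε ^ (p - 1) * ∫⁻ x in Ω, ‖fderiv ℝ v x‖ₑ ^ p)) := by
        rw [hH, lintegral_const_mul' _ _ hA, lintegral_add_left (hm₀.const_mul _),
          lintegral_const_mul _ hm₀, lintegral_const_mul _ hm₁,
          lintegral_lintegral_insertCoord i hF₀, lintegral_lintegral_insertCoord i hF₁,
          lintegral_indicator hΩ, lintegral_indicator hΩ]
    _ = C * 2 ^ (p - 1) * (ENNReal.ofReal ε)⁻¹ * (∫⁻ x in Ω, ‖v x‖ₑ ^ p) +
          C * 2 ^ (p - 1) * ENNReal.ofReal ε ^ (p - 1) *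
            ∫⁻ x in Ω, ‖fderiv ℝ v x‖ₑ ^ p := by ring
    _ ≤ _ := by
        gcongr
        exact hsmall ε hε (min_le_left _ _)

end Trace

section Compactness

variable {E : Type*} [NormedAddCommGroup E] [MeasurableSpace E] [BorelSpace E]

lemma enorm_average_rpow_le [ProperSpace E] (μ : Measure E) [IsFiniteMeasureOnCompacts μ]
    [μ.IsOpenPosMeasure] {v : E → ℝ} (hv : Continuous v) {p : ℝ} (hp : 1 < p) (y : E) {r : ℝ}
    (hr : 0 < r) :
    ‖⨍ z in ball y r, v z ∂μ‖ₑ ^ p ≤ (μ (ball y r))⁻¹ * ∫⁻ z in ball y r, ‖v z‖ₑ ^ p ∂μ := by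
  have hpos : μ (ball y r) ≠ 0 := (measure_ball_pos μ y hr).ne'
  have hfin : μ (ball y r) ≠ ∞ := measure_ball_lt_top.ne
  set ν := ((μ.restrict (ball y r)) univ)⁻¹ • μ.restrict (ball y r) with hν
  have hνp : IsProbabilityMeasure ν := by
    constructor
    simp [hν, ENNReal.inv_mul_cancel hpos hfin]
  calc ‖⨍ z in ball y r, v z ∂μ‖ₑ ^ p ≤ (∫⁻ z, ‖v z‖ₑ ∂ν) ^ p := by
        gcongr
        exact enorm_integral_le_lintegral_enorm _
    _ ≤ ν univ ^ (p - 1) * ∫⁻ z, ‖v z‖ₑ ^ p ∂ν :=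
        lintegral_rpow_le_measure_univ_mul _ hp hv.enorm.measurable.aemeasurable
    _ = _ := by
        rw [measure_univ, ENNReal.one_rpow, one_mul, hν, lintegral_smul_measure]
        simp

lemma average_ball_sub [ProperSpace E] (μ : Measure E) [IsFiniteMeasureOnCompacts μ]
    {v v' : E → ℝ} (hv : Continuous v) (hv' : Continuous v') (y : E) (r : ℝ) :
    ⨍ z in ball y r, (v z - v' z) ∂μ = ⨍ z in ball y r, v z ∂μ - ⨍ z in ball y r, v' z ∂μ := by
  have hint : ∀ {f : E → ℝ}, Continuous f → IntegrableOn f (ball y r) μ := fun hf =>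
    (hf.continuousOn.integrableOn_compact (isCompact_closedBall y r)).mono_set
      ball_subset_closedBall
  simp only [setAverage_eq]
  rw [integral_sub (hint hv) (hint hv'), smul_sub]

lemma lintegral_enorm_fderiv_sub_rpow_le [NormedSpace ℝ E] (μ : Measure E) {v v' : E → ℝ}
    (hv : ContDiff ℝ 1 v) (hv' : ContDiff ℝ 1 v') {p : ℝ} (hp : 1 < p) (Ω : Set E) :
    ∫⁻ x in Ω, ‖fderiv ℝ (fun y => v y - v' y) x‖ₑ ^ p ∂μ ≤
      2 ^ (p - 1) * ((∫⁻ x in Ω, ‖fderiv ℝ v x‖ₑ ^ p ∂μ) +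
        ∫⁻ x in Ω, ‖fderiv ℝ v' x‖ₑ ^ p ∂μ) := by
  rw [← lintegral_add_left (continuous_enorm_fderiv_rpow hv p).measurable,
    ← lintegral_const_mul' _ _ (by simp)]
  refine lintegral_mono fun x => ?_
  rw [fderiv_fun_sub (hv.differentiable one_ne_zero x) (hv'.differentiable one_ne_zero x)]
  refine le_trans ?_ (ENNReal.rpow_add_le_mul_rpow_add_rpow _ _ hp.le)
  gcongr
  exact enorm_sub_le

variable [NormedSpace ℝ E] [FiniteDimensional ℝ E]

/-- Along any sequence bounded in `W^{1,p}(Ω)`, finitely many ball averages at a time converge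
after passing to a subsequence. -/
lemma exists_subseq_tendsto_average (μ : Measure E) [IsFiniteMeasureOnCompacts μ]
    [μ.IsOpenPosMeasure] {p : ℝ} (hp : 1 < p) {Ω : Set E} {T : ℕ → Finset (E × ℝ)}
    (hT : ∀ i, ∀ b ∈ T i, 0 < b.2 ∧ ball b.1 b.2 ⊆ Ω) {u : ℕ → E → ℝ}
    (hu : ∀ k, Continuous (u k)) {M : ℝ≥0∞} (hM : M ≠ ∞)
    (hb : ∀ k, ∫⁻ x in Ω, ‖u k x‖ₑ ^ p ∂μ ≤ M) :
    ∃ φ : ℕ → ℕ, StrictMono φ ∧ ∀ i, ∀ b ∈ T i, ∃ a : ℝ,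
      Tendsto (fun j => ⨍ y in ball b.1 b.2, u (φ j) y ∂μ) atTop (𝓝 a) := by
  have hp0 : 0 < p := by linarith
  have := FiniteDimensional.proper_real E
  let X : ℕ → (Σ i, T i) → ℝ := fun k b => ⨍ y in ball b.2.1.1 b.2.1.2, u k y ∂μ
  let B : (Σ i, T i) → ℝ := fun b => (((μ (ball b.2.1.1 b.2.1.2))⁻¹ * M) ^ (1 / p)).toReal
  have hX : ∀ k, X k ∈ Set.pi univ fun b => Icc (-B b) (B b) := by
    rintro k ⟨i, b, hbT⟩ -
    obtain ⟨hb0, hbΩ⟩ := hT i b hbT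
    have hpos : μ (ball b.1 b.2) ≠ 0 := (measure_ball_pos μ b.1 hb0).ne'
    have h1 : ‖X k ⟨i, b, hbT⟩‖ₑ ^ p ≤ (μ (ball b.1 b.2))⁻¹ * M := by
      refine (enorm_average_rpow_le μ (hu k) hp b.1 hb0).trans ?_
      gcongr
      exact (lintegral_mono_set hbΩ).trans (hb k)
    have h2 : ‖X k ⟨i, b, hbT⟩‖ₑ ≤ ((μ (ball b.1 b.2))⁻¹ * M) ^ (1 / p) := by
      rwa [one_div, ENNReal.le_rpow_inv_iff hp0]
    have h3 : ((μ (ball b.1 b.2))⁻¹ * M) ^ (1 / p) ≠ ∞ :=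
      ENNReal.rpow_ne_top_of_nonneg (by positivity)
        (ENNReal.mul_ne_top (ENNReal.inv_ne_top.mpr hpos) hM)
    have h4 := ENNReal.toReal_mono h3 h2
    rw [toReal_enorm, Real.norm_eq_abs] at h4
    exact abs_le.mp h4
  obtain ⟨a, -, φ, hφ, hlim⟩ :=
    (isCompact_univ_pi fun b => isCompact_Icc (a := -B b) (b := B b)).tendsto_subseq hX
  exact ⟨φ, hφ, fun i b hbT => ⟨a ⟨i, b, hbT⟩, (tendsto_pi_nhds.mp hlim) ⟨i, b, hbT⟩⟩⟩

/-- A compactly controlled `L^p` norm has the Rellich property: sequences bounded in `W^{1,p}(Ω)`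
have subsequences converging in that norm. -/
lemma CompactlyControlled.exists_subseq_tendsto {μ : Measure E} [IsFiniteMeasureOnCompacts μ]
    [μ.IsOpenPosMeasure] {p : ℝ} (hp : 1 < p) {Ω : Set E} {ν : Measure E}
    (h : CompactlyControlled μ Ω p fun v => ∫⁻ x, ‖v x‖ₑ ^ p ∂ν) {u : ℕ → E → ℝ}
    (hu : ∀ k, ContDiff ℝ 1 (u k)) {M : ℝ≥0∞} (hM : M ≠ ∞)
    (hb : ∀ k, ∫⁻ x in Ω, ‖u k x‖ₑ ^ p ∂μ ≤ M)
    (hb' : ∀ k, ∫⁻ x in Ω, ‖fderiv ℝ (u k) x‖ₑ ^ p ∂μ ≤ M) :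
    ∃ φ : ℕ → ℕ, StrictMono φ ∧ ∃ g : E → ℝ, Measurable g ∧ ∫⁻ x, ‖g x‖ₑ ^ p ∂ν < ∞ ∧
      Tendsto (fun j => ∫⁻ x, ‖u (φ j) x - g x‖ₑ ^ p ∂ν) atTop (𝓝 0) := by
  have hp0 : 0 < p := by linarith
  have := FiniteDimensional.proper_real E
  choose T C hC hT hQ using fun i : ℕ =>
    h (((i + 1 : ℕ) : ℝ≥0∞)⁻¹) (ENNReal.inv_ne_zero.mpr (ENNReal.natCast_ne_top _))
  obtain ⟨φ, hφ, hlim⟩ :=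
    exists_subseq_tendsto_average μ hp hT (fun k => (hu k).continuous) hM hb
  refine ⟨φ, hφ, ?_⟩
  set q := ENNReal.ofReal p with hq
  have hq0 : q ≠ 0 := by simpa [hq] using hp0
  have hqt : q ≠ ∞ := ENNReal.ofReal_ne_top
  have hqr : q.toReal = p := ENNReal.toReal_ofReal hp0.le
  have hq1 : Fact (1 ≤ q) := ⟨by simpa [hq] using ENNReal.ofReal_le_ofReal hp.le⟩
  have hnorm : ∀ f : E → ℝ, eLpNorm f q ν = (∫⁻ x, ‖f x‖ₑ ^ p ∂ν) ^ (1 / p) := fun f => by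
    rw [eLpNorm_eq_lintegral_rpow_enorm_toReal hq0 hqt, hqr]
  have hmem : ∀ k, MemLp (u k) q ν := by
    intro k
    refine ⟨(hu k).continuous.aestronglyMeasurable, ?_⟩
    rw [hnorm]
    refine (ENNReal.rpow_ne_top_of_nonneg (by positivity) (ne_top_of_le_ne_top ?_
      (hQ 0 (u k) (hu k)))).lt_top
    refine ENNReal.add_ne_top.mpr ⟨ENNReal.mul_ne_top (hC 0) (ENNReal.sum_ne_top.mpr fun b _ =>
      ENNReal.rpow_ne_top_of_nonneg hp0.le enorm_ne_top), ENNReal.mul_ne_top (by simp)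
      (ne_top_of_le_ne_top hM (hb' k))⟩
  have hK : (2 : ℝ≥0∞) ^ (p - 1) * (M + M) ≠ ∞ :=
    ENNReal.mul_ne_top (by simp) (ENNReal.add_ne_top.mpr ⟨hM, hM⟩)
  set K := (2 : ℝ≥0∞) ^ (p - 1) * (M + M)
  have hcauchy : CauchySeq fun j => (hmem (φ j)).toLp (u (φ j)) := by
    rw [cauchySeq_iff_tendsto, uniformity_basis_edist.tendsto_right_iff]
    intro ε hε
    have hεp : 0 < ε ^ p := ENNReal.rpow_pos_of_nonneg hε hp0.le
    have hη : ∃ i : ℕ, ((i + 1 : ℕ) : ℝ≥0∞)⁻¹ * K < ε ^ p := by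
      have h1 : Tendsto (fun i : ℕ => ((i + 1 : ℕ) : ℝ≥0∞)⁻¹ * K) atTop (𝓝 (0 * K)) :=
        ENNReal.Tendsto.mul_const
          (ENNReal.tendsto_inv_nat_nhds_zero.comp (tendsto_add_atTop_nat 1)) (Or.inr hK)
      rw [zero_mul] at h1
      exact (h1.eventually (gt_mem_nhds hεp)).exists
    obtain ⟨i, hi⟩ := hη
    have hsum : Tendsto (fun j : ℕ × ℕ => C i * ∑ b ∈ T i,
        ‖⨍ y in ball b.1 b.2, u (φ j.1) y ∂μ - ⨍ y in ball b.1 b.2, u (φ j.2) y ∂μ‖ₑ ^ p +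
          ((i + 1 : ℕ) : ℝ≥0∞)⁻¹ * K) atTop (𝓝 (C i * 0 + ((i + 1 : ℕ) : ℝ≥0∞)⁻¹ * K)) := by
      refine Tendsto.add_const _ (ENNReal.Tendsto.const_mul ?_ (Or.inr (hC i)))
      rw [← Finset.sum_const_zero (s := T i)]
      refine tendsto_finsetSum _ fun b hbT => ?_
      obtain ⟨a, ha⟩ := hlim i b hbT
      rw [← prod_atTop_atTop_eq]
      have h1 := ((ha.comp tendsto_fst).sub (ha.comp (tendsto_snd (f := atTop)))).enorm
      simpa [ENNReal.zero_rpow_of_pos hp0] using h1.ennrpow_const p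
    rw [mul_zero, zero_add] at hsum
    filter_upwards [hsum.eventually (gt_mem_nhds hi)] with j hj
    simp only [Prod.map_fst, Prod.map_snd]
    rw [Lp.edist_toLp_toLp, hnorm, one_div, ENNReal.rpow_inv_lt_iff hp0]
    refine lt_of_le_of_lt ((hQ i _ ((hu (φ j.1)).sub (hu (φ j.2)))).trans ?_) hj
    refine add_le_add (mul_le_mul' le_rfl (Finset.sum_le_sum fun b _ => ?_)) ?_
    · rw [← average_ball_sub μ (hu _).continuous (hu _).continuous]
    · refine mul_le_mul' le_rfl ((lintegral_enorm_fderiv_sub_rpow_le μ (hu (φ j.1)) (hu (φ j.2))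
        hp Ω).trans ?_)
      exact mul_le_mul' le_rfl (add_le_add (hb' _) (hb' _))
  obtain ⟨f, hf⟩ := cauchySeq_tendsto_of_complete hcauchy
  have hfm := (Lp.memLp f).aestronglyMeasurable
  have hfg : f =ᵐ[ν] hfm.mk f := hfm.ae_eq_mk
  have hback : ∀ v : E → ℝ, ∫⁻ x, ‖v x‖ₑ ^ p ∂ν = eLpNorm v q ν ^ p := fun v => by
    rw [hnorm, ← ENNReal.rpow_mul, one_div_mul_cancel hp0.ne', ENNReal.rpow_one]
  refine ⟨hfm.mk f, hfm.stronglyMeasurable_mk.measurable, ?_, ?_⟩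
  · rw [hback, ← eLpNorm_congr_ae hfg]
    exact ENNReal.rpow_lt_top_of_nonneg hp0.le (Lp.memLp f).eLpNorm_ne_top
  · rw [Lp.tendsto_Lp_iff_tendsto_eLpNorm'] at hf
    have h1 : ∀ j, ∫⁻ x, ‖u (φ j) x - hfm.mk f x‖ₑ ^ p ∂ν =
        eLpNorm (⇑((hmem (φ j)).toLp (u (φ j))) - ⇑f) q ν ^ p := fun j => by
      rw [hback]
      congr 1
      exact eLpNorm_congr_ae ((hmem (φ j)).coeFn_toLp.symm.sub hfg.symm)
    simp_rw [h1]
    simpa [ENNReal.zero_rpow_of_pos hp0] using hf.ennrpow_const p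

end Compactness

section Geometry

lemma exists_sqrt_sum_sq_le_card_mul {ι : Type*} [Fintype ι] [Nonempty ι] (f : ι → ℝ) :
    ∃ i, ∃ σ : ℝ, (σ = 1 ∨ σ = -1) ∧ √(∑ j, f j ^ 2) ≤ Fintype.card ι * (σ * f i) := by
  obtain ⟨i, hi⟩ := Finite.exists_max fun j => |f j|
  have h : √(∑ j, f j ^ 2) ≤ Fintype.card ι * |f i| := by
    calc √(∑ j, f j ^ 2) ≤ ∑ j, |f j| := by
          refine Real.sqrt_le_iff.mpr ⟨Finset.sum_nonneg fun j _ => abs_nonneg _, ?_⟩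
          simp_rw [← sq_abs (f _)]
          exact Finset.sum_sq_le_sq_sum_of_nonneg fun j _ => abs_nonneg _
      _ ≤ ∑ _j : ι, |f i| := Finset.sum_le_sum fun j _ => hi j
      _ = _ := by simp
  rcases abs_cases (f i) with ⟨h1, -⟩ | ⟨h1, -⟩
  · exact ⟨i, 1, Or.inl rfl, by rwa [one_mul, ← h1]⟩
  · exact ⟨i, -1, Or.inr rfl, by rwa [neg_one_mul, ← h1]⟩

lemma abs_sub_le_of_sqrt_sum_sq_le {ι : Type*} [Fintype ι] (i : ι) {σ : ℝ} (hσ : σ = 1 ∨ σ = -1)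
    {X Y : ι → ℝ} {c L d : ℝ} (hc : 0 < c) (hd : 0 ≤ d) (hL : 0 ≤ L)
    (hX : √(∑ j, X j ^ 2) ≤ c * (σ * X i)) (hY : √(∑ j, Y j ^ 2) ≤ c * (σ * Y i))
    (hXY : ∀ j, j ≠ i → |X j - Y j| ≤ d)
    (hsum : |√(∑ j, X j ^ 2) - √(∑ j, Y j ^ 2)| ≤ L * d) :
    |X i - Y i| ≤ (L + Fintype.card ι) * c * d := by
  classical
  set G := √(∑ j, X j ^ 2)
  set H := √(∑ j, Y j ^ 2)
  have hG : 0 ≤ G := Real.sqrt_nonneg _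
  have hH : 0 ≤ H := Real.sqrt_nonneg _
  have hG2 : G ^ 2 = X i ^ 2 + ∑ j ∈ Finset.univ.erase i, X j ^ 2 := by
    rw [Real.sq_sqrt (Finset.sum_nonneg fun j _ => sq_nonneg _),
      Finset.add_sum_erase _ (fun j => X j ^ 2) (Finset.mem_univ i)]
  have hH2 : H ^ 2 = Y i ^ 2 + ∑ j ∈ Finset.univ.erase i, Y j ^ 2 := by
    rw [Real.sq_sqrt (Finset.sum_nonneg fun j _ => sq_nonneg _),
      Finset.add_sum_erase _ (fun j => Y j ^ 2) (Finset.mem_univ i)]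
  have hle : ∀ (f : ι → ℝ) j, |f j| ≤ √(∑ j, f j ^ 2) := fun f j => by
    rw [← Real.sqrt_sq_eq_abs]
    exact Real.sqrt_le_sqrt
      (Finset.single_le_sum (f := fun j => f j ^ 2) (fun j _ => sq_nonneg _) (Finset.mem_univ j))
  have hrest : |∑ j ∈ Finset.univ.erase i, X j ^ 2 - ∑ j ∈ Finset.univ.erase i, Y j ^ 2| ≤
      Fintype.card ι * (d * (G + H)) := by
    rw [← Finset.sum_sub_distrib]
    calc |∑ j ∈ Finset.univ.erase i, (X j ^ 2 - Y j ^ 2)|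
        ≤ ∑ j ∈ Finset.univ.erase i, |X j ^ 2 - Y j ^ 2| := Finset.abs_sum_le_sum_abs _ _
      _ ≤ ∑ j ∈ Finset.univ.erase i, d * (G + H) := by
          refine Finset.sum_le_sum fun j hj => ?_
          rw [sq_sub_sq, abs_mul, mul_comm]
          refine mul_le_mul (hXY j (Finset.ne_of_mem_erase hj)) ?_ (abs_nonneg _) hd
          exact (abs_add_le _ _).trans (add_le_add (hle X j) (hle Y j))
      _ ≤ ∑ _j : ι, d * (G + H) :=
          Finset.sum_le_sum_of_subset_of_nonneg (Finset.erase_subset _ _)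
            fun _ _ _ => by positivity
      _ = _ := by simp
  have hdiff : |X i ^ 2 - Y i ^ 2| ≤ (L + Fintype.card ι) * d * (G + H) := by
    have h1 : |G ^ 2 - H ^ 2| ≤ L * d * (G + H) := by
      rw [sq_sub_sq, abs_mul, mul_comm, abs_of_nonneg (add_nonneg hG hH)]
      gcongr
    have h2 : X i ^ 2 - Y i ^ 2 = (G ^ 2 - H ^ 2) -
        (∑ j ∈ Finset.univ.erase i, X j ^ 2 - ∑ j ∈ Finset.univ.erase i, Y j ^ 2) := by
      rw [hG2, hH2]
      ring
    rw [h2]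
    refine (abs_sub _ _).trans ?_
    linarith
  have hXi : 0 ≤ σ * X i := nonneg_of_mul_nonneg_right (hG.trans hX) hc
  have hYi : 0 ≤ σ * Y i := nonneg_of_mul_nonneg_right (hH.trans hY) hc
  have habs : |X i - Y i| = |σ * X i - σ * Y i| := by
    rcases hσ with rfl | rfl
    · simp
    · rw [← abs_neg]
      congr 1
      ring
  have hsq : X i ^ 2 - Y i ^ 2 = (σ * X i + σ * Y i) * (σ * X i - σ * Y i) := by
    rcases hσ with rfl | rfl <;> ring
  rw [hsq, abs_mul, abs_of_nonneg (add_nonneg hXi hYi)] at hdiff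
  rw [habs]
  rcases (add_nonneg hXi hYi).eq_or_lt with h0 | h0
  · have h1 : σ * X i = 0 := by linarith
    have h2 : σ * Y i = 0 := by linarith
    rw [h1, h2, sub_zero, abs_zero]
    positivity
  · refine le_of_mul_le_mul_left (hdiff.trans ?_) h0
    calc (L + Fintype.card ι) * d * (G + H)
        ≤ (L + Fintype.card ι) * d * (c * (σ * X i) + c * (σ * Y i)) := by gcongr
      _ = _ := by ring

lemma norm_add_smul_single_sq {ι : Type*} [Fintype ι] [DecidableEq ι] (y : EuclideanSpace ℝ ι)
    (i : ι) (s : ℝ) :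
    ‖y + s • EuclideanSpace.single i (1 : ℝ)‖ ^ 2 = ‖y‖ ^ 2 + 2 * s * y i + s ^ 2 := by
  rw [norm_add_sq_real, inner_smul_right, EuclideanSpace.inner_single_right, norm_smul]
  simp
  ring

/-- A vector in the closed ball with a dominating coordinate enters the open ball when that
coordinate is decreased. -/
lemma norm_add_smul_single_lt {ι : Type*} [Fintype ι] [DecidableEq ι] {y : EuclideanSpace ℝ ι}
    {i : ι} {σ : ℝ} (hσ : σ = 1 ∨ σ = -1) {c R τ : ℝ} (hc : 1 ≤ c) (hR : 0 < R) (hy : ‖y‖ ≤ R)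
    (hi : ‖y‖ ≤ c * (σ * y i)) (hτ : 0 < τ) (hτR : 4 * c * τ ≤ R) :
    ‖y + τ • (-σ) • EuclideanSpace.single i (1 : ℝ)‖ < R := by
  refine lt_of_pow_lt_pow_left₀ 2 hR.le ?_
  rw [smul_smul, norm_add_smul_single_sq]
  have hσ2 : σ ^ 2 = 1 := by rcases hσ with rfl | rfl <;> norm_num
  have h0 : 0 ≤ ‖y‖ := norm_nonneg y
  have ha : 0 ≤ σ * y i := nonneg_of_mul_nonneg_right (h0.trans hi) (by linarith)
  have hexp : ‖y‖ ^ 2 + 2 * (τ * -σ) * y i + (τ * -σ) ^ 2 =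
      ‖y‖ ^ 2 - 2 * τ * (σ * y i) + τ ^ 2 := by
    linear_combination τ ^ 2 * hσ2
  rw [hexp]
  have hτ4 : 4 * τ ≤ R := by nlinarith
  rcases le_or_gt ‖y‖ (R / 4) with h | h
  · nlinarith [mul_nonneg hτ.le ha]
  · have h1 : τ < 2 * (σ * y i) := by
      have : c * τ < c * (2 * (σ * y i)) := by linarith
      exact lt_of_mul_lt_mul_left this (by linarith)
    nlinarith

end Geometry

namespace CompactlyControlled

variable {E : Type*} [NormedAddCommGroup E] [NormedSpace ℝ E] [MeasurableSpace E]
  {μ ν : Measure E} {Ω : Set E} {p : ℝ} {F : (E → ℝ) → E → ℝ≥0∞}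

lemma lintegral_mono_set {S S' : Set E} (hS : S' ⊆ S)
    (h : CompactlyControlled μ Ω p fun v => ∫⁻ x in S, F v x ∂ν) :
    CompactlyControlled μ Ω p fun v => ∫⁻ x in S', F v x ∂ν :=
  h.mono fun _ _ => MeasureTheory.lintegral_mono_set hS

lemma lintegral_union {S S' : Set E}
    (h : CompactlyControlled μ Ω p fun v => ∫⁻ x in S, F v x ∂ν)
    (h' : CompactlyControlled μ Ω p fun v => ∫⁻ x in S', F v x ∂ν) :
    CompactlyControlled μ Ω p fun v => ∫⁻ x in S ∪ S', F v x ∂ν :=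
  (h.add h').mono fun _ _ => lintegral_union_le _ _ _

lemma lintegral_iUnion {ι : Type*} [Fintype ι] {S : ι → Set E}
    (h : ∀ i, CompactlyControlled μ Ω p fun v => ∫⁻ x in S i, F v x ∂ν) :
    CompactlyControlled μ Ω p fun v => ∫⁻ x in ⋃ i, S i, F v x ∂ν :=
  (sum Finset.univ fun i _ => h i).mono fun _ _ =>
    (lintegral_iUnion_le _ _).trans (tsum_fintype _).le

end CompactlyControlled

section Cusp

variable {m : ℕ}

/-- The projection `x ↦ x'` of `ℝ^{m+1} = ℝ^m × ℝ` onto the first factor. -/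
def horizontal (x : EuclideanSpace ℝ (Fin (m + 1))) : EuclideanSpace ℝ (Fin m) :=
  WithLp.toLp 2 fun i => x (Fin.castSucc i)

/-- The center of the ball in the cuspidal domain. -/
def ballCenter (m : ℕ) : EuclideanSpace ℝ (Fin (m + 1)) := EuclideanSpace.single (Fin.last m) 2

lemma sqrt_sum_castSucc_sq (x : EuclideanSpace ℝ (Fin (m + 1))) :
    √(∑ i : Fin m, x (Fin.castSucc i) ^ 2) = ‖horizontal x‖ := by
  rw [EuclideanSpace.norm_eq]
  simp [horizontal]

lemma continuous_norm_horizontal : Continuous fun x : EuclideanSpace ℝ (Fin (m + 1)) =>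
    ‖horizontal x‖ := by
  simp_rw [← sqrt_sum_castSucc_sq]
  fun_prop

lemma norm_sq_eq_horizontal (x : EuclideanSpace ℝ (Fin (m + 1))) :
    ‖x‖ ^ 2 = ‖horizontal x‖ ^ 2 + x (Fin.last m) ^ 2 := by
  simp [EuclideanSpace.norm_sq_eq, Fin.sum_univ_castSucc, horizontal]

lemma norm_sub_ballCenter_sq (x : EuclideanSpace ℝ (Fin (m + 1))) :
    ‖x - ballCenter m‖ ^ 2 = ‖horizontal x‖ ^ 2 + (x (Fin.last m) - 2) ^ 2 := by
  have h : horizontal (x - ballCenter m) = horizontal x := by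
    ext i
    simp [horizontal, ballCenter, Fin.castSucc_ne_last]
  rw [norm_sq_eq_horizontal, h]
  simp [ballCenter]

lemma norm_sub_ballCenter_lt_iff (x : EuclideanSpace ℝ (Fin (m + 1))) :
    ‖x - ballCenter m‖ < √2 ↔ ‖horizontal x‖ ^ 2 + (x (Fin.last m) - 2) ^ 2 < 2 := by
  rw [Real.lt_sqrt (norm_nonneg _), norm_sub_ballCenter_sq]

lemma mem_cuspDomain_iff {γ : ℝ → ℝ} {x : EuclideanSpace ℝ (Fin (m + 1))} :
    x ∈ cuspDomain m γ ↔
      (‖horizontal x‖ < γ (x (Fin.last m)) ∧ 0 < x (Fin.last m) ∧ x (Fin.last m) ≤ 1) ∨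
        ‖x - ballCenter m‖ < √2 := by
  rw [← mem_ball_iff_norm, ← sqrt_sum_castSucc_sq]
  rfl

lemma horizontal_add_smul_single_castSucc (x : EuclideanSpace ℝ (Fin (m + 1))) (i : Fin m)
    (s : ℝ) :
    horizontal (x + s • EuclideanSpace.single (Fin.castSucc i) (1 : ℝ)) =
      horizontal x + s • EuclideanSpace.single i (1 : ℝ) := by
  ext j
  simp [horizontal]

lemma horizontal_add_smul_single_last (x : EuclideanSpace ℝ (Fin (m + 1))) (s : ℝ) :
    horizontal (x + s • EuclideanSpace.single (Fin.last m) (1 : ℝ)) = horizontal x := by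
  ext j
  simp [horizontal, Fin.castSucc_ne_last]

/-- The properties of the profile function of a cusp that matter for the trace estimate. -/
structure IsCuspProfile (γ : ℝ → ℝ) (L : ℝ≥0) : Prop where
  lipschitz : LipschitzWith L γ
  zero : γ 0 = 0
  one : γ 1 = 1
  strictMonoOn : StrictMonoOn γ (Icc 0 1)

namespace IsCuspProfile

variable {γ : ℝ → ℝ} {L : ℝ≥0}

lemma mem_Icc_of_mem (hγ : IsCuspProfile γ L) {t : ℝ} (ht : t ∈ Icc (0 : ℝ) 1) :
    γ t ∈ Icc (0 : ℝ) 1 := by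
  have h0 := hγ.strictMonoOn.monotoneOn (left_mem_Icc.mpr zero_le_one) ht ht.1
  have h1 := hγ.strictMonoOn.monotoneOn ht (right_mem_Icc.mpr zero_le_one) ht.2
  rw [hγ.zero] at h0
  rw [hγ.one] at h1
  exact ⟨h0, h1⟩

lemma cuspWeight_mem_Icc (hγ : IsCuspProfile γ L) (x : EuclideanSpace ℝ (Fin (m + 1))) :
    cuspWeight m γ x ∈ Icc (0 : ℝ) 1 := by
  unfold cuspWeight
  split_ifs with h
  · exact hγ.mem_Icc_of_mem h.2.2
  · simp

lemma cuspWeight_eq (hγ : IsCuspProfile γ L) {x : EuclideanSpace ℝ (Fin (m + 1))}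
    (hx : ‖horizontal x‖ = γ (x (Fin.last m))) (ht : x (Fin.last m) ∈ Icc (0 : ℝ) 1) :
    cuspWeight m γ x = γ (x (Fin.last m)) := by
  unfold cuspWeight
  rw [sqrt_sum_castSucc_sq]
  split_ifs with h
  · rfl
  · rcases (hγ.mem_Icc_of_mem ht).2.lt_or_eq with h1 | h1
    · exact absurd ⟨hx, h1, ht⟩ h
    · exact h1.symm

lemma measurable_cuspWeight (hγ : IsCuspProfile γ L) : Measurable (cuspWeight m γ) := by
  have h1 : Measurable fun x : EuclideanSpace ℝ (Fin (m + 1)) => γ (x (Fin.last m)) :=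
    (hγ.lipschitz.continuous.comp (by fun_prop)).measurable
  have h2 : Measurable fun x : EuclideanSpace ℝ (Fin (m + 1)) => x (Fin.last m) := by fun_prop
  unfold cuspWeight
  simp_rw [sqrt_sum_castSucc_sq]
  refine Measurable.ite ?_ h1 measurable_const
  exact (measurableSet_eq_fun continuous_norm_horizontal.measurable h1).inter
    ((measurableSet_lt h1 measurable_const).inter
      ((measurableSet_le measurable_const h2).inter (measurableSet_le h2 measurable_const)))

lemma mem_ball_of_last_eq_one (hγ : IsCuspProfile γ L) {x : EuclideanSpace ℝ (Fin (m + 1))}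
    (hx : ‖horizontal x‖ < γ (x (Fin.last m))) (h1 : x (Fin.last m) = 1) :
    ‖x - ballCenter m‖ < √2 := by
  rw [norm_sub_ballCenter_lt_iff, h1]
  rw [h1, hγ.one] at hx
  nlinarith [norm_nonneg (horizontal x)]

lemma isOpen_cuspDomain (hγ : IsCuspProfile γ L) : IsOpen (cuspDomain m γ) := by
  have h : cuspDomain m γ = {x | ‖horizontal x‖ < γ (x (Fin.last m)) ∧ 0 < x (Fin.last m) ∧
      x (Fin.last m) < 1} ∪ ball (ballCenter m) (√2) := by
    ext x
    rw [mem_cuspDomain_iff, mem_union, mem_ball_iff_norm]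
    constructor
    · rintro (⟨h1, h2, h3⟩ | h)
      · rcases h3.lt_or_eq with h3 | h3
        · exact Or.inl ⟨h1, h2, h3⟩
        · exact Or.inr (hγ.mem_ball_of_last_eq_one h1 h3)
      · exact Or.inr h
    · rintro (⟨h1, h2, h3⟩ | h)
      · exact Or.inl ⟨h1, h2, h3.le⟩
      · exact Or.inr h
  have ht : Continuous fun x : EuclideanSpace ℝ (Fin (m + 1)) => x (Fin.last m) := by fun_prop
  rw [h]
  exact ((isOpen_lt continuous_norm_horizontal (hγ.lipschitz.continuous.comp ht)).inter
    ((isOpen_lt continuous_const ht).inter (isOpen_lt ht continuous_const))).union isOpen_ball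

/-- The closed cusp `{|x'| ≤ γ(xₙ), 0 ≤ xₙ ≤ 1}`. -/
def _root_.closedCusp (m : ℕ) (γ : ℝ → ℝ) : Set (EuclideanSpace ℝ (Fin (m + 1))) :=
  {x | ‖horizontal x‖ ≤ γ (x (Fin.last m)) ∧ 0 ≤ x (Fin.last m) ∧ x (Fin.last m) ≤ 1}

lemma isCompact_closedCusp (hγ : IsCuspProfile γ L) : IsCompact (closedCusp m γ) := by
  have ht : Continuous fun x : EuclideanSpace ℝ (Fin (m + 1)) => x (Fin.last m) := by fun_prop
  refine Metric.isCompact_of_isClosed_isBounded ?_ ?_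
  · exact (isClosed_le continuous_norm_horizontal (hγ.lipschitz.continuous.comp ht)).inter
      ((isClosed_le continuous_const ht).inter (isClosed_le ht continuous_const))
  · refine (isBounded_closedBall (x := 0) (r := 2)).subset fun x hx => ?_
    rw [mem_closedBall_zero_iff]
    have h1 := (hγ.mem_Icc_of_mem hx.2).2
    have h2 := norm_sq_eq_horizontal x
    obtain ⟨h3, h4, h5⟩ := hx
    refine le_of_sq_le_sq ?_ zero_le_two
    nlinarith [norm_nonneg (horizontal x)]

lemma cuspDomain_subset : cuspDomain m γ ⊆ closedCusp m γ ∪ closedBall (ballCenter m) (√2) := by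
  intro x hx
  rcases mem_cuspDomain_iff.mp hx with h | h
  · exact Or.inl ⟨h.1.le, h.2.1.le, h.2.2⟩
  · exact Or.inr (mem_closedBall_iff_norm.mpr h.le)

lemma frontier_cuspDomain_subset (hγ : IsCuspProfile γ L) : frontier (cuspDomain m γ) ⊆
    {x | ‖horizontal x‖ = γ (x (Fin.last m)) ∧ x (Fin.last m) ∈ Icc 0 1} ∪
      {x | ‖x - ballCenter m‖ = √2} := by
  intro x hx
  rw [hγ.isOpen_cuspDomain.frontier_eq, Set.mem_sdiff, mem_cuspDomain_iff] at hx
  obtain ⟨hx, hx'⟩ := hx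
  push Not at hx'
  rcases closure_minimal cuspDomain_subset
    (hγ.isCompact_closedCusp.isClosed.union isClosed_closedBall) hx with h | h
  · refine Or.inl ⟨?_, h.2⟩
    obtain ⟨h1, h2, h3⟩ := h
    by_contra hne
    have hlt := lt_of_le_of_ne h1 hne
    rcases h2.eq_or_lt with h0 | h0
    · rw [← h0, hγ.zero] at hlt
      exact absurd hlt (norm_nonneg _).not_gt
    · exact absurd h3 (hx'.1 hlt h0).not_ge
  · exact Or.inr (le_antisymm (mem_closedBall_iff_norm.mp h) hx'.2)

lemma compactlyControlled_lintegral_closedCusp (hγ : IsCuspProfile γ L) {p : ℝ} (hp : 1 < p) :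
    CompactlyControlled volume (cuspDomain m γ) p fun v =>
      ∫⁻ x in closedCusp m γ, ‖v x‖ₑ ^ p := by
  refine compactlyControlled_of_translate_subset volume hp hγ.isOpen_cuspDomain
    hγ.isCompact_closedCusp (EuclideanSpace.single (Fin.last m) (1 : ℝ)) (s₀ := 1 / 2)
    (by norm_num) ?_
  rintro τ ⟨hτ, hτ'⟩ x ⟨hx, h0, h1⟩
  have hγx := (hγ.mem_Icc_of_mem ⟨h0, h1⟩).2
  have hlast : (x + τ • EuclideanSpace.single (Fin.last m) (1 : ℝ)) (Fin.last m) =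
      x (Fin.last m) + τ := by simp
  rw [mem_cuspDomain_iff, norm_sub_ballCenter_lt_iff, horizontal_add_smul_single_last, hlast]
  have hn := norm_nonneg (horizontal x)
  rcases lt_trichotomy (x (Fin.last m) + τ) 1 with h | h | h
  · refine Or.inl ⟨hx.trans_lt (hγ.strictMonoOn ⟨h0, h1⟩ ⟨by linarith, h.le⟩ (by linarith)),
      by linarith, h.le⟩
  · right
    have : γ (x (Fin.last m)) < 1 := by
      rw [← hγ.one]
      exact hγ.strictMonoOn ⟨h0, h1⟩ (right_mem_Icc.mpr zero_le_one) (by linarith)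
    rw [h]
    nlinarith
  · right
    nlinarith

/-- Points of the closed ball whose displacement from the center is dominated by its `i`-th
coordinate, taken with sign `σ`. -/
def _root_.closedBallSector (i : Fin (m + 1)) (σ : ℝ) : Set (EuclideanSpace ℝ (Fin (m + 1))) :=
  {x | ‖x - ballCenter m‖ ≤ √2 ∧
    ‖x - ballCenter m‖ ≤ (m + 1 : ℝ) * (σ * (x - ballCenter m) i)}

lemma _root_.isClosed_closedBallSector (i : Fin (m + 1)) (σ : ℝ) :
    IsClosed (closedBallSector i σ) := by
  have h : Continuous fun x : EuclideanSpace ℝ (Fin (m + 1)) => ‖x - ballCenter m‖ := by fun_prop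
  have h' : Continuous fun x : EuclideanSpace ℝ (Fin (m + 1)) =>
      (m + 1 : ℝ) * (σ * (x - ballCenter m) i) := by fun_prop
  exact (isClosed_le h continuous_const).inter (isClosed_le h h')

lemma _root_.closedBall_subset_iUnion_closedBallSector :
    closedBall (ballCenter m) (√2) ⊆
      ⋃ q : Fin (m + 1) × Bool, closedBallSector q.1 (cond q.2 1 (-1)) := by
  intro x hx
  obtain ⟨i, σ, hσ, h⟩ := exists_sqrt_sum_sq_le_card_mul fun i => (x - ballCenter m) i
  have hn : √(∑ j, (x - ballCenter m) j ^ 2) = ‖x - ballCenter m‖ := by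
    simp [EuclideanSpace.norm_eq]
  rw [hn, Fintype.card_fin] at h
  push_cast at h
  rw [mem_iUnion]
  rcases hσ with rfl | rfl
  · exact ⟨(i, true), mem_closedBall_iff_norm.mp hx, h⟩
  · exact ⟨(i, false), mem_closedBall_iff_norm.mp hx, h⟩

lemma _root_.cond_one_neg_one_eq (b : Bool) :
    cond b (1 : ℝ) (-1) = 1 ∨ cond b (1 : ℝ) (-1) = -1 := by
  cases b <;> simp

lemma _root_.add_smul_single_mem_cuspDomain {i : Fin (m + 1)} {σ : ℝ} (hσ : σ = 1 ∨ σ = -1)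
    {x : EuclideanSpace ℝ (Fin (m + 1))} (hx : x ∈ closedBallSector i σ) {τ : ℝ} (hτ : 0 < τ)
    (hτ' : τ ≤ √2 / (4 * (m + 1))) :
    x + τ • (-σ) • EuclideanSpace.single i (1 : ℝ) ∈ cuspDomain m γ := by
  rw [mem_cuspDomain_iff]
  right
  rw [add_sub_right_comm]
  refine norm_add_smul_single_lt hσ (c := m + 1) ?_ (by positivity) hx.1 hx.2 hτ ?_
  · have : (0 : ℝ) ≤ m := m.cast_nonneg
    linarith
  · rw [le_div_iff₀ (by positivity)] at hτ'
    linarith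

lemma compactlyControlled_lintegral_cuspDomain (hγ : IsCuspProfile γ L) {p : ℝ} (hp : 1 < p) :
    CompactlyControlled volume (cuspDomain m γ) p fun v =>
      ∫⁻ x in cuspDomain m γ, ‖v x‖ₑ ^ p := by
  refine CompactlyControlled.lintegral_mono_set (cuspDomain_subset.trans
    (union_subset_union_right _ closedBall_subset_iUnion_closedBallSector)) ?_
  refine (hγ.compactlyControlled_lintegral_closedCusp hp).lintegral_union
    (CompactlyControlled.lintegral_iUnion fun q => ?_)
  refine compactlyControlled_of_translate_subset volume hp hγ.isOpen_cuspDomain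
    ((isCompact_closedBall (ballCenter m) (√2)).of_isClosed_subset
      (isClosed_closedBallSector _ _) fun x hx => mem_closedBall_iff_norm.mpr hx.1)
    ((-(cond q.2 (1 : ℝ) (-1))) • EuclideanSpace.single q.1 (1 : ℝ))
    (s₀ := √2 / (4 * (m + 1))) (by positivity) ?_
  rintro τ ⟨hτ, hτ'⟩ x hx
  exact add_smul_single_mem_cuspDomain (cond_one_neg_one_eq _) hx hτ hτ'

lemma _root_.abs_sub_le_dist_forgetCoord {i j : Fin (m + 1)} (hj : j ≠ i)
    (x y : EuclideanSpace ℝ (Fin (m + 1))) :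
    |x j - y j| ≤ dist (forgetCoord i x) (forgetCoord i y) := by
  obtain ⟨k, rfl⟩ := Fin.exists_succAbove_eq hj
  exact dist_le_pi_dist (forgetCoord i x) (forgetCoord i y) k

lemma compactlyControlled_lintegral_sphere (hγ : IsCuspProfile γ L) {p : ℝ} (hp : 1 < p) :
    CompactlyControlled volume (cuspDomain m γ) p fun v =>
      ∫⁻ x in {x | ‖x - ballCenter m‖ = √2}, ENNReal.ofReal (cuspWeight m γ x) *
        ‖v x‖ₑ ^ p ∂μH[(m : ℝ)] := by
  have hsub : {x | ‖x - ballCenter m‖ = √2} ⊆ ⋃ q : Fin (m + 1) × Bool,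
      {x | ‖x - ballCenter m‖ = √2} ∩ closedBallSector q.1 (cond q.2 1 (-1)) := by
    rw [← inter_iUnion]
    exact fun x hx => ⟨hx, closedBall_subset_iUnion_closedBallSector
      (mem_closedBall_iff_norm.mpr (le_of_eq hx))⟩
  refine CompactlyControlled.lintegral_mono_set hsub
    (CompactlyControlled.lintegral_iUnion fun q => ?_)
  have hclosed : IsClosed {x : EuclideanSpace ℝ (Fin (m + 1)) | ‖x - ballCenter m‖ = √2} :=
    isClosed_eq (by fun_prop) continuous_const
  have hσ := cond_one_neg_one_eq q.2
  set σ := cond q.2 (1 : ℝ) (-1)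
  refine compactlyControlled_graph (L := (0 + Fintype.card (Fin (m + 1))) * (m + 1)) hp
    hγ.isOpen_cuspDomain.measurableSet
    (hγ.compactlyControlled_lintegral_cuspDomain hp)
    (hclosed.inter (isClosed_closedBallSector _ _)).measurableSet q.1 (σ := -σ) ?_ (by positivity)
    ?_ (fun x _ => (hγ.cuspWeight_mem_Icc x).1) (fun x _ => (hγ.cuspWeight_mem_Icc x).2)
    (ε₀ := √2 / (4 * (m + 1))) (by positivity) ?_
  · rcases hσ with h | h <;> simp [h]
  · rintro x ⟨hx, hx'⟩ y ⟨hy, hy'⟩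
    have hn : ∀ z : EuclideanSpace ℝ (Fin (m + 1)),
        √(∑ j, (z - ballCenter m) j ^ 2) = ‖z - ballCenter m‖ := fun z => by
      simp [EuclideanSpace.norm_eq]
    have h := abs_sub_le_of_sqrt_sum_sq_le q.1 hσ (X := fun j => (x - ballCenter m) j)
      (Y := fun j => (y - ballCenter m) j) (c := m + 1) (L := 0)
      (d := dist (forgetCoord q.1 x) (forgetCoord q.1 y)) (by positivity) dist_nonneg le_rfl
      (by rw [hn]; exact hx'.2) (by rw [hn]; exact hy'.2) ?_ ?_
    · simpa using h
    · intro j hj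
      simpa using abs_sub_le_dist_forgetCoord hj x y
    · rw [hn, hn, hx, hy]
      simp
  · rintro x ⟨-, hx⟩ τ ⟨hτ, hτ'⟩
    refine add_smul_single_mem_cuspDomain hσ hx hτ (hτ'.trans ?_)
    exact mul_le_of_le_one_right (by positivity) (hγ.cuspWeight_mem_Icc x).2

lemma compactlyControlled_lintegral_lateral (hγ : IsCuspProfile γ L) (hm : 1 ≤ m) {p : ℝ}
    (hp : 1 < p) :
    CompactlyControlled volume (cuspDomain m γ) p fun v =>
      ∫⁻ x in {x | ‖horizontal x‖ = γ (x (Fin.last m)) ∧ x (Fin.last m) ∈ Icc 0 1},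
        ENNReal.ofReal (cuspWeight m γ x) * ‖v x‖ₑ ^ p ∂μH[(m : ℝ)] := by
  have : Nonempty (Fin m) := ⟨⟨0, hm⟩⟩
  have hm1 : (1 : ℝ) ≤ m := by exact_mod_cast hm
  set A : Set (EuclideanSpace ℝ (Fin (m + 1))) :=
    {x | ‖horizontal x‖ = γ (x (Fin.last m)) ∧ x (Fin.last m) ∈ Icc 0 1} with hA
  have hsub : A ⊆ ⋃ q : Fin m × Bool, A ∩ {x | ‖horizontal x‖ ≤
      (m : ℝ) * (cond q.2 1 (-1) * x (Fin.castSucc q.1))} := by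
    rw [← inter_iUnion]
    refine fun x hx => ⟨hx, ?_⟩
    obtain ⟨i, σ, hσ, h⟩ := exists_sqrt_sum_sq_le_card_mul fun i : Fin m => x (Fin.castSucc i)
    rw [sqrt_sum_castSucc_sq, Fintype.card_fin] at h
    rw [mem_iUnion]
    rcases hσ with rfl | rfl
    · exact ⟨(i, true), h⟩
    · exact ⟨(i, false), h⟩
  refine CompactlyControlled.lintegral_mono_set hsub
    (CompactlyControlled.lintegral_iUnion fun q => ?_)
  have ht : Continuous fun x : EuclideanSpace ℝ (Fin (m + 1)) => x (Fin.last m) := by fun_prop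
  have hclosedA : IsClosed A :=
    (isClosed_eq continuous_norm_horizontal (hγ.lipschitz.continuous.comp ht)).inter
      (isClosed_Icc.preimage ht)
  have hclosed : IsClosed {x : EuclideanSpace ℝ (Fin (m + 1)) | ‖horizontal x‖ ≤
      (m : ℝ) * (cond q.2 1 (-1) * x (Fin.castSucc q.1))} :=
    isClosed_le continuous_norm_horizontal (by fun_prop)
  have hσ := cond_one_neg_one_eq q.2
  set σ := cond q.2 (1 : ℝ) (-1)
  refine compactlyControlled_graph (L := (L + Fintype.card (Fin m)) * m) hp
    hγ.isOpen_cuspDomain.measurableSet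
    (hγ.compactlyControlled_lintegral_cuspDomain hp)
    (hclosedA.inter hclosed).measurableSet (Fin.castSucc q.1) (σ := -σ) ?_ (by positivity)
    ?_ (fun x _ => (hγ.cuspWeight_mem_Icc x).1) (fun x _ => (hγ.cuspWeight_mem_Icc x).2)
    (ε₀ := 1 / (4 * m)) (by positivity) ?_
  · rcases hσ with h | h <;> simp [h]
  · rintro x ⟨⟨hx, -⟩, hx'⟩ y ⟨⟨hy, -⟩, hy'⟩
    refine abs_sub_le_of_sqrt_sum_sq_le q.1 hσ (X := fun j => x (Fin.castSucc j))
      (Y := fun j => y (Fin.castSucc j)) (c := m) (L := L)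
      (d := dist (forgetCoord (Fin.castSucc q.1) x) (forgetCoord (Fin.castSucc q.1) y))
      (by positivity) dist_nonneg L.coe_nonneg
      (by rw [sqrt_sum_castSucc_sq]; exact hx') (by rw [sqrt_sum_castSucc_sq]; exact hy') ?_ ?_
    · intro j hj
      exact abs_sub_le_dist_forgetCoord (fun h => hj (Fin.castSucc_injective m h)) x y
    · rw [sqrt_sum_castSucc_sq, sqrt_sum_castSucc_sq, hx, hy, ← Real.dist_eq]
      refine (hγ.lipschitz.dist_le_mul _ _).trans ?_
      gcongr
      exact abs_sub_le_dist_forgetCoord (Fin.castSucc_ne_last q.1).symm x y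
  · rintro x ⟨⟨hx, ht01⟩, hx'⟩ τ ⟨hτ, hτ'⟩
    rw [hγ.cuspWeight_eq hx ht01] at hτ'
    have hpos : 0 < γ (x (Fin.last m)) := by
      by_contra! hle
      have : 1 / (4 * (m : ℝ)) * γ (x (Fin.last m)) ≤ 0 :=
        mul_nonpos_of_nonneg_of_nonpos (by positivity) hle
      linarith
    have ht0 : 0 < x (Fin.last m) := by
      refine ht01.1.lt_of_ne fun h => ?_
      rw [← h, hγ.zero] at hpos
      exact lt_irrefl _ hpos
    have hlast : (x + τ • (-σ) • EuclideanSpace.single (Fin.castSucc q.1) (1 : ℝ)) (Fin.last m) =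
        x (Fin.last m) := by simp [(Fin.castSucc_ne_last q.1).symm]
    rw [mem_cuspDomain_iff, hlast]
    refine Or.inl ⟨?_, ht0, ht01.2⟩
    rw [smul_smul, horizontal_add_smul_single_castSucc, ← smul_smul]
    refine norm_add_smul_single_lt hσ hm1 hpos hx.le hx' hτ ?_
    rw [div_mul_eq_mul_div, one_mul, le_div_iff₀ (by positivity)] at hτ'
    linarith

lemma compactlyControlled_trace (hγ : IsCuspProfile γ L) (hm : 1 ≤ m) {p : ℝ} (hp : 1 < p) :
    CompactlyControlled volume (cuspDomain m γ) p fun v =>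
      ∫⁻ x in frontier (cuspDomain m γ), ENNReal.ofReal (cuspWeight m γ x) *
        ‖v x‖ₑ ^ p ∂μH[(m : ℝ)] :=
  CompactlyControlled.lintegral_mono_set hγ.frontier_cuspDomain_subset
    ((hγ.compactlyControlled_lintegral_lateral hm hp).lintegral_union
      (hγ.compactlyControlled_lintegral_sphere hp))

end IsCuspProfile

end Cusp

lemma cuspDomain_congr {m : ℕ} {γ γ₁ : ℝ → ℝ} (h : EqOn γ γ₁ (Icc 0 1)) :
    cuspDomain m γ = cuspDomain m γ₁ := by
  unfold cuspDomain
  congr 1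
  ext x
  constructor <;> rintro ⟨h1, h2, h3⟩ <;> refine ⟨?_, h2, h3⟩
  · rwa [← h ⟨h2.le, h3⟩]
  · rwa [h ⟨h2.le, h3⟩]

lemma cuspWeight_congr {m : ℕ} {γ γ₁ : ℝ → ℝ} (h : EqOn γ γ₁ (Icc 0 1)) :
    cuspWeight m γ = cuspWeight m γ₁ := by
  ext x
  unfold cuspWeight
  by_cases hx : x (Fin.last m) ∈ Icc (0 : ℝ) 1
  · rw [h hx]
  · rw [if_neg fun h' => hx h'.2.2, if_neg fun h' => hx h'.2.2]

lemma exists_isCuspProfile {γ γ' : ℝ → ℝ} (hγ0 : γ 0 = 0) (hγ1 : γ 1 = 1)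
    (hγcont : ContinuousOn γ (Icc 0 1)) (hγmono : StrictMonoOn γ (Icc 0 1))
    (hγderiv : ∀ t ∈ Icc (0 : ℝ) 1, HasDerivWithinAt γ (γ' t) (Icc 0 1) t)
    (hγ'mono : MonotoneOn γ' (Ioo 0 1)) :
    ∃ γ₁ L, IsCuspProfile γ₁ L ∧ EqOn γ γ₁ (Icc 0 1) := by
  have hder : ∀ t ∈ Ioo (0 : ℝ) 1, HasDerivAt γ (γ' t) t := fun t ht =>
    (hγderiv t (Ioo_subset_Icc_self ht)).hasDerivAt (Icc_mem_nhds ht.1 ht.2)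
  have hconv : ConvexOn ℝ (Icc 0 1) γ := by
    refine MonotoneOn.convexOn_of_deriv (convex_Icc 0 1) hγcont ?_ ?_
    · rw [interior_Icc]
      exact fun t ht => (hder t ht).differentiableAt.differentiableWithinAt
    · rw [interior_Icc]
      exact hγ'mono.congr fun t ht => (hder t ht).deriv.symm
  have hmem1 : (1 : ℝ) ∈ Icc (0 : ℝ) 1 := right_mem_Icc.mpr zero_le_one
  have hle : ∀ t ∈ Icc (0 : ℝ) 1, γ' t ≤ γ' 1 := by
    intro t ht
    rcases ht.2.lt_or_eq with h | rfl
    · exact (hconv.le_slope_of_hasDerivWithinAt ht hmem1 h (hγderiv t ht)).trans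
        (hconv.slope_le_of_hasDerivWithinAt ht hmem1 h (hγderiv 1 hmem1))
    · exact le_rfl
  have key : ∀ s ∈ Icc (0 : ℝ) 1, ∀ t ∈ Icc (0 : ℝ) 1, s ≤ t →
      dist (γ s) (γ t) ≤ (γ' 1).toNNReal * dist s t := by
    intro s hs t ht hst
    rcases hst.lt_or_eq with h | rfl
    · have h1 := (hconv.slope_le_of_hasDerivWithinAt hs ht h (hγderiv t ht)).trans (hle t ht)
      rw [slope_def_field, div_le_iff₀ (sub_pos.mpr h)] at h1
      rw [dist_comm, dist_comm s, Real.dist_eq, Real.dist_eq, abs_of_pos (sub_pos.mpr h),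
        abs_of_pos (sub_pos.mpr (hγmono hs ht h))]
      refine h1.trans (mul_le_mul_of_nonneg_right (Real.le_coe_toNNReal _) (sub_pos.mpr h).le)
    · simp
  have hlip : LipschitzOnWith (γ' 1).toNNReal γ (Icc 0 1) := by
    refine LipschitzOnWith.of_dist_le_mul fun s hs t ht => ?_
    rcases le_total s t with h | h
    · exact key s hs t ht h
    · rw [dist_comm, dist_comm s]
      exact key t ht s hs h
  obtain ⟨γ₁, hγ₁, heq⟩ := hlip.extend_real
  refine ⟨γ₁, _, ⟨hγ₁, ?_, ?_, hγmono.congr heq⟩, heq⟩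
  · rw [← heq (left_mem_Icc.mpr zero_le_one), hγ0]
  · rw [← heq hmem1, hγ1]

lemma norm_gradient_eq {E : Type*} [NormedAddCommGroup E] [InnerProductSpace ℝ E] [CompleteSpace E]
    (v : E → ℝ) (x : E) : ‖gradient v x‖ = ‖fderiv ℝ v x‖ :=
  (InnerProductSpace.toDual ℝ E).symm.norm_map _

lemma enorm_rpow_eq_ofReal {F : Type*} [NormedAddCommGroup F] (a : F) {p : ℝ} (hp : 0 ≤ p) :
    ‖a‖ₑ ^ p = ENNReal.ofReal (‖a‖ ^ p) := by
  rw [← ofReal_norm, ENNReal.ofReal_rpow_of_nonneg (norm_nonneg a) hp]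

lemma lintegral_le_one_of_setIntegral_gradient_le {E : Type*} [NormedAddCommGroup E]
    [InnerProductSpace ℝ E] [CompleteSpace E] [MeasurableSpace E] [BorelSpace E] {μ : Measure E}
    [IsFiniteMeasureOnCompacts μ] {Ω K : Set E} (hK : IsCompact K) (hΩK : Ω ⊆ K) {p : ℝ}
    (hp : 0 ≤ p) {v : E → ℝ} (hv : ContDiff ℝ 1 v)
    (h : ∫ x in Ω, (‖gradient v x‖ ^ p + |v x| ^ p) ∂μ ≤ 1) :
    ∫⁻ x in Ω, ‖v x‖ₑ ^ p ∂μ ≤ 1 ∧ ∫⁻ x in Ω, ‖fderiv ℝ v x‖ₑ ^ p ∂μ ≤ 1 := by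
  simp_rw [norm_gradient_eq] at h
  have hcont : Continuous fun x => ‖fderiv ℝ v x‖ ^ p + |v x| ^ p :=
    ((hv.continuous_fderiv one_ne_zero).norm.rpow_const fun _ => Or.inr hp).add
      (hv.continuous.abs.rpow_const fun _ => Or.inr hp)
  have hint : IntegrableOn (fun x => ‖fderiv ℝ v x‖ ^ p + |v x| ^ p) Ω μ :=
    (hcont.continuousOn.integrableOn_compact hK).mono_set hΩK
  have h1 : ∫⁻ x in Ω, ENNReal.ofReal (‖fderiv ℝ v x‖ ^ p + |v x| ^ p) ∂μ ≤ 1 := by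
    rw [← ofReal_integral_eq_lintegral_ofReal hint (ae_of_all _ fun x => by positivity)]
    exact ENNReal.ofReal_le_one.mpr h
  constructor <;> refine le_trans (lintegral_mono fun x => ?_) h1 <;>
    rw [enorm_rpow_eq_ofReal _ hp]
  · exact ENNReal.ofReal_le_ofReal (le_add_of_nonneg_left (by positivity))
  · exact ENNReal.ofReal_le_ofReal (le_add_of_nonneg_right (by positivity))

theorem trace_embedding_compact (m : ℕ) (hm : 1 ≤ m) (p : ℝ) (hp : 1 < p)
    (γ γ' : ℝ → ℝ) (hγ0 : γ 0 = 0) (hγ1 : γ 1 = 1)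
    (hγcont : ContinuousOn γ (Set.Icc 0 1))
    (hγmono : StrictMonoOn γ (Set.Icc 0 1))
    (hγnonneg : ∀ t ∈ Set.Icc (0 : ℝ) 1, 0 ≤ γ t)
    (hγderiv : ∀ t ∈ Set.Icc (0 : ℝ) 1, HasDerivWithinAt γ (γ' t) (Set.Icc 0 1) t)
    (hγ'mono : StrictMonoOn γ' (Set.Ioo 0 1))
    (hγ'lim : Filter.Tendsto γ' (nhdsWithin 0 (Set.Ioi 0)) (nhds 0))
    (u : ℕ → EuclideanSpace ℝ (Fin (m + 1)) → ℝ)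
    (hu : ∀ k, ContDiff ℝ 1 (u k))
    (hbdd : ∀ k, (∫ x in cuspDomain m γ, (‖gradient (u k) x‖ ^ p + |u k x| ^ p)) ≤ 1)
    :
    ∃ φ : ℕ → ℕ, StrictMono φ ∧
      ∃ g : EuclideanSpace ℝ (Fin (m + 1)) → ℝ, Measurable g ∧
        (∫⁻ x in frontier (cuspDomain m γ),
            ENNReal.ofReal (|g x| ^ p * cuspWeight m γ x) ∂(μH[(m : ℝ)])) < ⊤ ∧
        Filter.Tendsto
          (fun j => ∫⁻ x in frontier (cuspDomain m γ),
            ENNReal.ofReal (|u (φ j) x - g x| ^ p * cuspWeight m γ x) ∂(μH[(m : ℝ)]))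
          Filter.atTop (nhds 0) := by
  obtain ⟨γ₁, L, hγ, heq⟩ :=
    exists_isCuspProfile hγ0 hγ1 hγcont hγmono hγderiv hγ'mono.monotoneOn
  have hp0 : 0 ≤ p := by linarith
  rw [cuspDomain_congr heq] at hbdd ⊢
  rw [cuspWeight_congr heq]
  have hb := fun k => lintegral_le_one_of_setIntegral_gradient_le
    (hγ.isCompact_closedCusp.union (isCompact_closedBall (ballCenter m) (√2)))
    IsCuspProfile.cuspDomain_subset hp0 (hu k) (hbdd k)
  set w : EuclideanSpace ℝ (Fin (m + 1)) → ℝ≥0∞ :=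
    fun x => ENNReal.ofReal (cuspWeight m γ₁ x) with hw
  set ν := ((μH[(m : ℝ)] : Measure (EuclideanSpace ℝ (Fin (m + 1)))).restrict
    (frontier (cuspDomain m γ₁))).withDensity w
  have hwm : Measurable w := hγ.measurable_cuspWeight.ennreal_ofReal
  have hν : ∀ {v : EuclideanSpace ℝ (Fin (m + 1)) → ℝ}, Measurable v →
      ∫⁻ x, ‖v x‖ₑ ^ p ∂ν =
        ∫⁻ x in frontier (cuspDomain m γ₁), w x * ‖v x‖ₑ ^ p ∂μH[(m : ℝ)] := fun hv =>
    lintegral_withDensity_eq_lintegral_mul _ hwm (hv.enorm.pow_const p)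
  have hform : ∀ {v : EuclideanSpace ℝ (Fin (m + 1)) → ℝ}, Measurable v →
      ∫⁻ x in frontier (cuspDomain m γ₁),
        ENNReal.ofReal (|v x| ^ p * cuspWeight m γ₁ x) ∂μH[(m : ℝ)] = ∫⁻ x, ‖v x‖ₑ ^ p ∂ν := by
    intro v hv
    rw [hν hv]
    refine lintegral_congr fun x => ?_
    rw [enorm_rpow_eq_ofReal _ hp0, hw, mul_comm,
      ENNReal.ofReal_mul (hγ.cuspWeight_mem_Icc x).1, Real.norm_eq_abs]
  have hctrl : CompactlyControlled volume (cuspDomain m γ₁) p fun v => ∫⁻ x, ‖v x‖ₑ ^ p ∂ν :=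
    (hγ.compactlyControlled_trace hm hp).mono fun v hv => (hν hv.continuous.measurable).le
  obtain ⟨φ, hφ, g, hg, hgfin, hlim⟩ := hctrl.exists_subseq_tendsto hp hu ENNReal.one_ne_top
    (fun k => (hb k).1) (fun k => (hb k).2)
  refine ⟨φ, hφ, g, hg, ?_, ?_⟩
  · rwa [hform hg]
  · have h := fun j => hform ((hu (φ j)).continuous.measurable.sub hg)
    simp only [Pi.sub_apply] at h
    simp_rw [h]
    exact hlim
end
end

section
/- Let 1 < p < ∞ and λ > 0. Let (μ_n)_{n≥0} and (a_n)_{n≥0} be sequences of positive real numbers such that λ ≤ a_{n+1}^p ≤ μ_n for all n ≥ 0, and μ_n ≤ a_{n+1}^{p−1} a_n for all n ≥ 1. Then the sequence (μ_n)_{n≥0} is non-increasing, the sequence (a_n)_{n≥1} is non-increasing, and the sequences (μ_n) and (a_{n+1}^p) converge to a common limit μ satisfying μ ≥ λ. (This is the numerical core of the convergence of the inverse iteration scheme: with a_{n+1} = ‖w_{n+1}‖_{W^{1,p}(Ω_γ)}, the iteration constants μ_n and the Sobolev norms ‖w_{n+1}‖^p_{W^{1,p}} are non-increasing and converge to the same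 limit ≥ λ_p.) -/
open Filter

theorem inverse_iteration_numeric (p lam : ℝ) (hp : 1 < p) (hlam : 0 < lam)
    (μ a : ℕ → ℝ) (hμpos : ∀ n, 0 < μ n) (hapos : ∀ n, 0 < a n)
    (hlow : ∀ n, lam ≤ a (n + 1) ^ p) (hup : ∀ n, a (n + 1) ^ p ≤ μ n)
    (hiter : ∀ n, 1 ≤ n → μ n ≤ a (n + 1) ^ (p - 1) * a n) :
    Antitone μ ∧ Antitone (fun n => a (n + 1)) ∧
      ∃ L : ℝ, lam ≤ L ∧ Filter.Tendsto μ Filter.atTop (nhds L) ∧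
        Filter.Tendsto (fun n => a (n + 1) ^ p) Filter.atTop (nhds L) := by
  have hpow : ∀ n, a n ^ (p - 1) * a n = a n ^ p := fun n => by
    rw [← Real.rpow_add_one (hapos n).ne', sub_add_cancel]
  have ha : ∀ n, a (n + 1 + 1) ≤ a (n + 1) := fun n => by
    have h := (hup (n + 1)).trans (hiter (n + 1) n.succ_pos)
    rw [← hpow] at h
    exact le_of_mul_le_mul_left h (Real.rpow_pos_of_pos (hapos _) _)
  have hμa : ∀ n, μ (n + 1) ≤ a (n + 1) ^ p := fun n => by
    refine (hiter (n + 1) n.succ_pos).trans ?_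
    rw [← hpow (n + 1)]
    exact mul_le_mul_of_nonneg_right
      (Real.rpow_le_rpow (hapos _).le (ha n) (sub_nonneg.2 hp.le)) (hapos _).le
  have hμ : Antitone μ := antitone_nat_of_succ_le fun n => (hμa n).trans (hup n)
  have hlb : ∀ n, lam ≤ μ n := fun n => (hlow n).trans (hup n)
  have hlim : Tendsto μ atTop (nhds (⨅ n, μ n)) :=
    tendsto_atTop_ciInf hμ ⟨lam, Set.forall_mem_range.2 hlb⟩
  exact ⟨hμ, antitone_nat_of_succ_le ha, _, le_ciInf hlb, hlim,
    tendsto_of_tendsto_of_tendsto_of_le_of_le ((tendsto_add_atTop_iff_nat 1).2 hlim) hlim hμa hup⟩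
end
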